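/- arXiv:math/0207225 — 2 statements merged into one kernel-verified Lean document; each statement's English description precedes it below -/
import Mathlib

section
/- For every integer m ≥ 2 and every exponent 1 < p < ∞, the spectral projections S^0_R(Δ_{S^{2m-1}}) = E_{Δ_{S^{2m-1}}}([0,R)) are uniformly bounded from H^p(S^{2m-1}) to L^p(S^{2m-1}); that is, sup_{R>0} ‖S^0_R(Δ_{S^{2m-1}})‖_{H^p(S^{2m-1}) → L^p(S^{2m-1})} < ∞. -/
/-!
STATEMENT 0: For every integer m ≥ 2 and every 1 < p < ∞, the spectral projections
S^0_R(Δ_{S^{2m-1}}) = E_{Δ_{S^{2m-1}}}([0,R)) are uniformly bounded from H^p(S^{2m-1})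
to L^p(S^{2m-1}).

Formalization notes: the sphere S^{2m-1} is the unit sphere of ℂ^m = `EuclideanSpace ℂ (Fin m)`.
The surface measure σ is pinned down (uniquely) by its total mass 2π^m/(m-1)! and invariance
under the unitary group, which acts transitively on the sphere.  The spectral projection
E_{Δ}([0,R)) is pinned down (uniquely) as the continuous linear operator on L²(σ) acting as the
identity on (restrictions to the sphere of) harmonic homogeneous polynomials of degree d — i.e.
smooth harmonic d-homogeneous functions on ℂ^m, viewed as ℝ^{2m} — whose Laplace–Beltrami
eigenvalue d(d+2m-2) is < R, and as 0 on those with eigenvalue ≥ R; these spherical harmonics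
span L²(σ).  H^p is the L^p-closure of the class A(∂B_m) of boundary restrictions of functions
holomorphic on the ball and continuous on the closed ball, so uniform boundedness from H^p to L^p
is expressed on that dense class.
-/

open MeasureTheory Metric Complex
open scoped ENNReal NNReal

noncomputable section

instance (m : ℕ) : MeasurableSpace (EuclideanSpace ℂ (Fin m)) := borel _
instance (m : ℕ) : BorelSpace (EuclideanSpace ℂ (Fin m)) := ⟨rfl⟩

/-- The unit sphere `S^{2m-1}` in `ℂ^m`. -/
abbrev USphere (m : ℕ) := ↥(Metric.sphere (0 : EuclideanSpace ℂ (Fin m)) 1)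

/-- The map on the sphere induced by a unitary map of `ℂ^m`. -/
def rotMap (m : ℕ) (U : EuclideanSpace ℂ (Fin m) ≃ₗᵢ[ℂ] EuclideanSpace ℂ (Fin m))
    (z : USphere m) : USphere m :=
  ⟨U z, by
    have hz := mem_sphere_zero_iff_norm.mp z.2
    exact mem_sphere_zero_iff_norm.mpr (by rw [U.norm_map, hz])⟩

/-- `σ` is the Lebesgue surface measure of `S^{2m-1}`: the unique rotation-invariant Borel
measure with total mass `ω_{2m-1} = 2π^m/(m-1)!` (the unitary group acts transitively). -/
def IsSurfaceMeasure (m : ℕ) (σ : Measure (USphere m)) : Prop :=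
  σ Set.univ = ENNReal.ofReal (2 * Real.pi ^ m / (Nat.factorial (m - 1))) ∧
  ∀ U : EuclideanSpace ℂ (Fin m) ≃ₗᵢ[ℂ] EuclideanSpace ℂ (Fin m),
    Measure.map (rotMap m U) σ = σ

/-- An orthonormal (over ℝ) basis of `ℂ^m` viewed as `ℝ^{2m}`. -/
def rbasis (m : ℕ) (q : Fin m × Bool) : EuclideanSpace ℂ (Fin m) :=
  EuclideanSpace.single q.1 (if q.2 then 1 else Complex.I)

/-- The Euclidean Laplacian of `f : ℂ^m → ℂ` viewed as a function on `ℝ^{2m}`. -/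
def lapE (m : ℕ) (f : EuclideanSpace ℂ (Fin m) → ℂ) (x : EuclideanSpace ℂ (Fin m)) : ℂ :=
  ∑ q : Fin m × Bool, iteratedFDeriv ℝ 2 f x ![rbasis m q, rbasis m q]

/-- (Positively) homogeneous of degree `d` under real dilations. -/
def Homog (m : ℕ) (d : ℕ) (f : EuclideanSpace ℂ (Fin m) → ℂ) : Prop :=
  ∀ (c : ℝ) (x : EuclideanSpace ℂ (Fin m)), f (c • x) = (c ^ d : ℝ) • f x

/-- A (solid) spherical harmonic of degree `d`: a smooth harmonic function on
`ℂ^m ≅ ℝ^{2m}` homogeneous of degree `d`; such functions are exactly the harmonic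
homogeneous polynomials of degree `d`. -/
def IsSolidHarmonic (m : ℕ) (d : ℕ) (f : EuclideanSpace ℂ (Fin m) → ℂ) : Prop :=
  ContDiff ℝ (⊤ : ℕ∞) f ∧ Homog m d f ∧ ∀ x, lapE m f x = 0

/-- The class `A(∂B_m)`: restrictions to the closed ball of functions continuous on the closed
unit ball and holomorphic on the open ball; `H^p` is the `L^p(σ)`-closure of this class. -/
def IsAnalyticBd (m : ℕ) (f : EuclideanSpace ℂ (Fin m) → ℂ) : Prop :=
  ContinuousOn f (Metric.closedBall (0 : EuclideanSpace ℂ (Fin m)) 1) ∧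
  DifferentiableOn ℂ f (Metric.ball (0 : EuclideanSpace ℂ (Fin m)) 1)

section Holomorphic

variable {E : Type*} [NormedAddCommGroup E] [NormedSpace ℂ E] [FiniteDimensional ℂ E]

/-- Directional derivatives of a holomorphic function of several variables are holomorphic. -/
theorem differentiableOn_fderiv_apply {f : E → ℂ} {U : Set E} (hU : IsOpen U)
    (hf : DifferentiableOn ℂ f U) (v : E) : DifferentiableOn ℂ (fun z => fderiv ℂ f z v) U := by
  intro z₀ hz₀
  apply DifferentiableAt.differentiableWithinAt
  have : ProperSpace E := FiniteDimensional.proper ℂ E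
  obtain ⟨ε, hε, hεU⟩ := Metric.isOpen_iff.mp hU z₀ hz₀
  set R : ℝ := ε / 4 with hR
  have hRpos : 0 < R := by positivity
  have hsub : closedBall z₀ (3 * R) ⊆ U :=
    (closedBall_subset_ball (by linarith)).trans hεU
  have hcont : ContinuousOn f (closedBall z₀ (3 * R)) := hf.continuousOn.mono hsub
  obtain ⟨M, hM⟩ := (isCompact_closedBall z₀ (3 * R)).exists_bound_of_continuousOn hcont
  have hM0 : 0 ≤ M := (norm_nonneg _).trans (hM z₀ (mem_closedBall_self (by positivity)))
  set r : ℝ := R / (‖v‖ + 1) with hr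
  have hrpos : 0 < r := by positivity
  have hrv : r * ‖v‖ ≤ R := by
    rw [hr, div_mul_eq_mul_div, div_le_iff₀ (by positivity)]
    nlinarith [norm_nonneg v]
  have hnear : ∀ z ∈ ball z₀ R, ∀ ζ ∈ closedBall (0 : ℂ) r, z + ζ • v ∈ closedBall z₀ (2 * R) := by
    intro z hz ζ hζ
    rw [mem_closedBall, dist_eq_norm]
    rw [mem_ball, dist_eq_norm] at hz
    rw [mem_closedBall_zero_iff] at hζ
    calc ‖z + ζ • v - z₀‖ = ‖(z - z₀) + ζ • v‖ := by congr 1; abel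
      _ ≤ ‖z - z₀‖ + ‖ζ‖ * ‖v‖ := (norm_add_le _ _).trans (by rw [norm_smul])
      _ ≤ R + r * ‖v‖ := by gcongr
      _ ≤ 2 * R := by linarith
  have hsub2 : closedBall z₀ (2 * R) ⊆ U := (closedBall_subset_closedBall (by linarith)).trans hsub
  have hdiff : ∀ w ∈ closedBall z₀ (2 * R), DifferentiableAt ℂ f w := fun w hw =>
    hf.differentiableAt (hU.mem_nhds (hsub2 hw))
  have hbound : ∀ w ∈ closedBall z₀ (2 * R), ‖fderiv ℂ f w‖ ≤ 2 * M / R := by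
    intro w hw
    have hwsub : ball w R ⊆ closedBall z₀ (3 * R) := by
      intro y hy
      rw [mem_closedBall] at hw ⊢
      rw [mem_ball] at hy
      linarith [dist_triangle y w z₀]
    refine norm_fderiv_le_div_of_mapsTo_ball (hf.mono (hwsub.trans hsub)) ?_ hRpos
    intro y hy
    rw [mem_closedBall, dist_eq_norm]
    linarith [norm_sub_le (f y) (f w), hM y (hwsub hy), hM w (hwsub (mem_ball_self hRpos))]
  have hline : ∀ z : E, ∀ ζ : ℂ, HasDerivAt (fun ζ : ℂ => z + ζ • v) v ζ := fun z ζ => by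
    simpa using ((hasDerivAt_id ζ).smul_const v).const_add z
  set c : ℝ → ℂ := fun θ => (2 * Real.pi * I)⁻¹ * (deriv (circleMap 0 r) θ *
    ((circleMap 0 r θ) ^ 2)⁻¹) with hc
  have hcm : ∀ θ, circleMap (0 : ℂ) r θ ∈ closedBall (0 : ℂ) r := fun θ =>
    circleMap_mem_closedBall _ hrpos.le θ
  have hccont : Continuous c := by
    refine continuous_const.mul (Continuous.mul ?_ (Continuous.inv₀ (by fun_prop) ?_))
    · rw [funext (deriv_circleMap 0 r)]; fun_prop
    · intro θ; simp [circleMap, hrpos.ne']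
  have hcauchy : ∀ z ∈ ball z₀ R, fderiv ℂ f z v =
      ∫ θ in (0 : ℝ)..2 * Real.pi, c θ * f (z + circleMap 0 r θ • v) := by
    intro z hz
    have hd : DiffContOnCl ℂ (fun ζ : ℂ => f (z + ζ • v)) (ball 0 r) := by
      apply DifferentiableOn.diffContOnCl
      rw [closure_ball _ hrpos.ne']
      intro ζ hζ
      exact ((hdiff _ (hnear z hz ζ hζ)).comp ζ (hline z ζ).differentiableAt).differentiableWithinAt
    have h1 : deriv (fun ζ : ℂ => f (z + ζ • v)) 0 = fderiv ℂ f z v := by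
      have h0 := hdiff _ (hnear z hz 0 (mem_closedBall_self hrpos.le))
      have := h0.hasFDerivAt.comp_hasDerivAt (0 : ℂ) (hline z 0)
      simpa [Function.comp_def] using this.deriv
    have h2 := hd.deriv_eq_smul_circleIntegral hrpos
    rw [h1, circleIntegral, smul_eq_mul, eq_comm, ← eq_inv_mul_iff_mul_eq₀ two_pi_I_ne_zero,
      ← intervalIntegral.integral_const_mul] at h2
    rw [h2]
    refine intervalIntegral.integral_congr fun θ _ => ?_
    simp only [hc, smul_eq_mul, sub_zero, one_div]
    ring
  have hev : (fun z => fderiv ℂ f z v) =ᶠ[nhds z₀]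
      fun z => ∫ θ in (0 : ℝ)..2 * Real.pi, c θ * f (z + circleMap 0 r θ • v) :=
    Filter.eventuallyEq_of_mem (ball_mem_nhds z₀ hRpos) hcauchy
  refine DifferentiableAt.congr_of_eventuallyEq ?_ hev
  have hFc : ∀ z ∈ ball z₀ R, Continuous fun θ => c θ * f (z + circleMap 0 r θ • v) := by
    intro z hz
    refine hccont.mul ?_
    rw [← continuousOn_univ]
    exact hcont.comp (by fun_prop) fun θ _ =>
      closedBall_subset_closedBall (by linarith) (hnear z hz _ (hcm θ))
  borelize E
  refine (intervalIntegral.hasFDerivAt_integral_of_dominated_of_fderiv_le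
    (F := fun z θ => c θ * f (z + circleMap 0 r θ • v))
    (F' := fun z θ => c θ • fderiv ℂ f (z + circleMap 0 r θ • v))
    (bound := fun θ => ‖c θ‖ * (2 * M / R)) (s := ball z₀ R) (ball_mem_nhds z₀ hRpos)
    ?_ ?_ ?_ ?_ ?_ ?_).differentiableAt
  · filter_upwards [ball_mem_nhds z₀ hRpos] with z hz
    exact (hFc z hz).aestronglyMeasurable
  · exact (hFc z₀ (mem_ball_self hRpos)).intervalIntegrable _ _
  · refine hccont.aestronglyMeasurable.smul (Measurable.aestronglyMeasurable ?_)
    exact (measurable_fderiv ℂ f).comp (by fun_prop : Continuous _).measurable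
  · refine Filter.Eventually.of_forall fun θ _ z hz => ?_
    rw [norm_smul]
    gcongr
    exact hbound _ (hnear z hz _ (hcm θ))
  · exact (by fun_prop : Continuous _).intervalIntegrable _ _
  · refine Filter.Eventually.of_forall fun θ _ z hz => ?_
    have h0 := (hdiff _ (hnear z hz _ (hcm θ))).hasFDerivAt
    have h1 : HasFDerivAt (fun z => z + circleMap 0 r θ • v) (ContinuousLinearMap.id ℂ E) z :=
      (hasFDerivAt_id z).add_const _
    simpa using (h0.comp z h1).const_mul (c θ)

/-- A holomorphic function of several variables is smooth. -/
theorem contDiffOn_of_differentiableOn_complex {f : E → ℂ} {U : Set E} (hU : IsOpen U)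
    (hf : DifferentiableOn ℂ f U) (n : ℕ) : ContDiffOn ℂ n f U := by
  induction n generalizing f with
  | zero => exact contDiffOn_zero.mpr hf.continuousOn
  | succ n ih =>
    refine contDiffOn_succ_of_fderiv_apply hf
      (fun h => absurd h (WithTop.natCast_ne_top _)) fun y => ?_
    exact (ih (differentiableOn_fderiv_apply hU hf y)).congr fun x hx => by
      rw [fderivWithin_of_isOpen hU hx]

end Holomorphic

section Taylor

variable {m : ℕ}

/-- The homogeneous component of degree `d` in the Taylor expansion of `F` at the origin. -/
def homogComp (d : ℕ) (F : EuclideanSpace ℂ (Fin m) → ℂ) (z : EuclideanSpace ℂ (Fin m)) : ℂ :=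
  (d.factorial : ℂ)⁻¹ * iteratedFDeriv ℂ d F 0 (fun _ => z)

theorem contDiff_homogComp (d : ℕ) (F : EuclideanSpace ℂ (Fin m) → ℂ) (n : WithTop ℕ∞) :
    ContDiff ℂ n (homogComp d F) :=
  contDiff_const.mul ((ContinuousMultilinearMap.contDiff _).comp
    (contDiff_pi.2 fun _ => contDiff_id))

theorem homogComp_smul (d : ℕ) (F : EuclideanSpace ℂ (Fin m) → ℂ) (c : ℂ)
    (z : EuclideanSpace ℂ (Fin m)) : homogComp d F (c • z) = c ^ d * homogComp d F z := by
  have := (iteratedFDeriv ℂ d F 0).map_smul_univ (fun _ => c) (fun _ => z)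
  simp only [Finset.prod_const, Finset.card_univ, Fintype.card_fin, smul_eq_mul] at this
  rw [homogComp, this, homogComp]
  ring

/-- Holomorphic functions are harmonic. -/
theorem lapE_eq_zero_of_contDiff {f : EuclideanSpace ℂ (Fin m) → ℂ} (hf : ContDiff ℂ 2 f)
    (x : EuclideanSpace ℂ (Fin m)) : lapE m f x = 0 := by
  have h : iteratedFDeriv ℝ 2 f x =
      (iteratedFDeriv ℂ 2 f x).restrictScalars ℝ :=
    (hf.contDiffAt.restrictScalars_iteratedFDeriv (𝕜 := ℝ)).symm
  rw [lapE, Fintype.sum_prod_type, h]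
  refine Finset.sum_eq_zero fun j _ => ?_
  rw [Fintype.sum_bool]
  set e : EuclideanSpace ℂ (Fin m) := EuclideanSpace.single j 1 with he
  have h1 : rbasis m (j, true) = e := by simp [rbasis, he]
  have h2 : rbasis m (j, false) = I • e := by
    ext i
    simp [rbasis, he]
  have h3 : (![I • e, I • e] : Fin 2 → EuclideanSpace ℂ (Fin m)) = fun i => I • ![e, e] i := by
    ext i : 1; fin_cases i <;> rfl
  have h4 := (iteratedFDeriv ℂ 2 f x).map_smul_univ (fun _ => I) ![e, e]
  rw [h1, h2, h3]
  simp only [ContinuousMultilinearMap.coe_restrictScalars]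
  rw [h4]
  simp

theorem isSolidHarmonic_homogComp (d : ℕ) (F : EuclideanSpace ℂ (Fin m) → ℂ) :
    IsSolidHarmonic m d (homogComp d F) := by
  refine ⟨(contDiff_homogComp d F _).restrict_scalars ℝ, fun c x => ?_,
    lapE_eq_zero_of_contDiff (contDiff_homogComp d F 2)⟩
  rw [← Complex.coe_smul, homogComp_smul]
  simp

theorem iteratedDeriv_slice_eq {F : EuclideanSpace ℂ (Fin m) → ℂ}
    (hF : DifferentiableOn ℂ F (ball 0 1)) (d : ℕ) (z : EuclideanSpace ℂ (Fin m)) :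
    iteratedDeriv d (fun l : ℂ => F (l • z)) 0 = iteratedFDeriv ℂ d F 0 (fun _ => z) := by
  set g : ℂ →L[ℂ] EuclideanSpace ℂ (Fin m) :=
    (ContinuousLinearMap.id ℂ ℂ).smulRight z with hg
  have hF' : ContDiffOn ℂ d F (ball 0 1) := contDiffOn_of_differentiableOn_complex isOpen_ball hF d
  have ho : IsOpen (g ⁻¹' ball 0 1) := isOpen_ball.preimage g.continuous
  have h0 : g 0 ∈ ball (0 : EuclideanSpace ℂ (Fin m)) 1 := by simp
  have h := g.iteratedFDerivWithin_comp_right hF' isOpen_ball.uniqueDiffOn ho.uniqueDiffOn h0 le_rfl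
  rw [iteratedFDerivWithin_of_isOpen d ho h0, iteratedFDerivWithin_of_isOpen d isOpen_ball h0] at h
  have h' : (fun l : ℂ => F (l • z)) = F ∘ g := by ext; simp [hg]
  rw [iteratedDeriv_eq_iteratedFDeriv, h', h]
  simp [hg]

theorem IsAnalyticBd.slice {F : EuclideanSpace ℂ (Fin m) → ℂ} (hF : IsAnalyticBd m F)
    {z : EuclideanSpace ℂ (Fin m)} (hz : ‖z‖ = 1) :
    DiffContOnCl ℂ (fun l : ℂ => F (l • z)) (ball 0 1) := by
  constructor
  · refine hF.2.comp (by fun_prop) fun l hl => ?_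
    simpa [norm_smul, hz] using hl
  · rw [closure_ball _ one_ne_zero]
    refine hF.1.comp (by fun_prop) fun l hl => ?_
    simpa [norm_smul, hz] using hl

theorem IsAnalyticBd.norm_homogComp_le {F : EuclideanSpace ℂ (Fin m) → ℂ} (hF : IsAnalyticBd m F)
    {B : ℝ} (hB : ∀ w ∈ closedBall (0 : EuclideanSpace ℂ (Fin m)) 1, ‖F w‖ ≤ B) (d : ℕ)
    {z : EuclideanSpace ℂ (Fin m)} (hz : ‖z‖ = 1) : ‖homogComp d F z‖ ≤ B := by
  have h := norm_iteratedDeriv_le_of_forall_mem_sphere_norm_le d one_pos (hF.slice hz) (C := B)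
    fun l hl => hB _ (by
      rw [mem_sphere_zero_iff_norm] at hl
      simp [norm_smul, hz, hl])
  rw [iteratedDeriv_slice_eq hF.2] at h
  have hd : (0 : ℝ) < d.factorial := by positivity
  rw [homogComp, norm_mul, norm_inv, Complex.norm_natCast, inv_mul_le_iff₀ hd]
  simpa using h

theorem IsAnalyticBd.hasSum_homogComp {F : EuclideanSpace ℂ (Fin m) → ℂ} (hF : IsAnalyticBd m F)
    {z : EuclideanSpace ℂ (Fin m)} (hz : ‖z‖ = 1) {r : ℝ} (hr0 : 0 ≤ r) (hr : r < 1) :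
    HasSum (fun d => (r : ℂ) ^ d * homogComp d F z) (F ((r : ℂ) • z)) := by
  have h := hasSum_taylorSeries_on_ball (hF.slice hz).differentiableOn
    (z := (r : ℂ)) (by simpa [abs_of_nonneg hr0] using hr)
  have he : (fun d : ℕ => (r : ℂ) ^ d * homogComp d F z) = fun d : ℕ =>
      (d.factorial : ℂ)⁻¹ • ((r : ℂ) - 0) ^ d • iteratedDeriv d (fun l : ℂ => F (l • z)) 0 := by
    funext d
    rw [iteratedDeriv_slice_eq hF.2]
    simp only [homogComp, smul_eq_mul, sub_zero]
    ring
  rw [he]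
  exact h

/-- Functions in the ball algebra are uniform limits on the sphere of dilated partial sums of
their homogeneous expansion. -/
theorem IsAnalyticBd.exists_partialSum_approx {F : EuclideanSpace ℂ (Fin m) → ℂ}
    (hF : IsAnalyticBd m F) {ε : ℝ} (hε : 0 < ε) :
    ∃ (r : ℝ) (M : ℕ), ∀ z : USphere m,
      ‖∑ d ∈ Finset.range M, (r : ℂ) ^ d * homogComp d F z - F z‖ ≤ ε := by
  have hK := isCompact_closedBall (0 : EuclideanSpace ℂ (Fin m)) 1
  obtain ⟨B, hB⟩ := hK.exists_bound_of_continuousOn hF.1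
  have huc := hK.uniformContinuousOn_of_continuous hF.1
  obtain ⟨δ, hδ, hδF⟩ := Metric.uniformContinuousOn_iff.mp huc (ε / 2) (by positivity)
  set r : ℝ := max (1 - δ / 2) 0 with hr
  have hr0 : 0 ≤ r := le_max_right _ _
  have hr1 : r < 1 := max_lt (by linarith) one_pos
  have hrδ : 1 - r < δ := by linarith [le_max_left (1 - δ / 2) 0]
  have hlim : Filter.Tendsto (fun M : ℕ => r ^ M * B / (1 - r)) Filter.atTop (nhds 0) := by
    have := ((tendsto_pow_atTop_nhds_zero_of_lt_one hr0 hr1).mul_const B).div_const (1 - r)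
    simpa using this
  obtain ⟨M, hM⟩ := (hlim.eventually (gt_mem_nhds (half_pos hε))).exists
  refine ⟨r, M, fun z => ?_⟩
  have hz : ‖(z : EuclideanSpace ℂ (Fin m))‖ = 1 := mem_sphere_zero_iff_norm.mp z.2
  have hzm : (z : EuclideanSpace ℂ (Fin m)) ∈ closedBall (0 : EuclideanSpace ℂ (Fin m)) 1 := by
    simp [hz]
  have hrz : (r : ℂ) • (z : EuclideanSpace ℂ (Fin m)) ∈
      closedBall (0 : EuclideanSpace ℂ (Fin m)) 1 := by
    simp [norm_smul, hz, abs_of_nonneg hr0, hr1.le]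
  have hd : dist ((r : ℂ) • (z : EuclideanSpace ℂ (Fin m))) z < δ := by
    rw [dist_eq_norm]
    have : (r : ℂ) • (z : EuclideanSpace ℂ (Fin m)) - z = ((r - 1 : ℝ) : ℂ) • z.1 := by
      push_cast; rw [sub_smul, one_smul]
    rw [this, norm_smul, hz, mul_one, Complex.norm_real, Real.norm_eq_abs, abs_sub_comm,
      abs_of_pos (by linarith)]
    exact hrδ
  have h1 := hδF _ hrz _ hzm hd
  have h2 : ‖∑ d ∈ Finset.range M, (r : ℂ) ^ d * homogComp d F z - F ((r : ℂ) • z.1)‖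
      ≤ r ^ M * B / (1 - r) := by
    have hsum := hF.hasSum_homogComp hz hr0 hr1
    have hb : ∀ d, ‖(r : ℂ) ^ d * homogComp d F z‖ ≤ B * r ^ d := fun d => by
      rw [norm_mul, norm_pow, Complex.norm_real, Real.norm_of_nonneg hr0, mul_comm]
      exact mul_le_mul_of_nonneg_right (hF.norm_homogComp_le hB d hz) (pow_nonneg hr0 d)
    have := norm_sub_le_of_geometric_bound_of_hasSum hr1 hb hsum M
    rwa [mul_comm B] at this
  rw [dist_eq_norm] at h1
  have := norm_sub_le_norm_sub_add_norm_sub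
    (∑ d ∈ Finset.range M, (r : ℂ) ^ d * homogComp d F z) (F ((r : ℂ) • z.1)) (F z)
  linarith

end Taylor

section Riesz

open AddCircle ComplexConjugate

instance twoPiPos : Fact (0 < 2 * Real.pi) := ⟨Real.two_pi_pos⟩

/-- The trigonometric polynomial with given Fourier coefficients. -/
def trigPoly : (ℤ →₀ ℂ) →ₗ[ℂ] C(AddCircle (2 * Real.pi), ℂ) :=
  Finsupp.linearCombination ℂ (fun n : ℤ => fourier n)

/-- The Riesz projection, keeping the Fourier coefficients of nonnegative index. -/
def rieszProj : (ℤ →₀ ℂ) →ₗ[ℂ] (ℤ →₀ ℂ) where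
  toFun a := a.filter (fun n => 0 ≤ n)
  map_add' _ _ := Finsupp.filter_add
  map_smul' _ _ := Finsupp.filter_smul

theorem rieszProj_apply (a : ℤ →₀ ℂ) (k : ℤ) : rieszProj a k = if 0 ≤ k then a k else 0 :=
  Finsupp.filter_apply _ _ _

theorem rieszProj_single (k : ℤ) (c : ℂ) :
    rieszProj (Finsupp.single k c) = if 0 ≤ k then Finsupp.single k c else 0 := by
  split_ifs with h
  · exact Finsupp.filter_single_of_pos _ h
  · exact Finsupp.filter_single_of_neg _ h

theorem trigPoly_single (k : ℤ) (c : ℂ) (t : AddCircle (2 * Real.pi)) :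
    trigPoly (Finsupp.single k c) t = c * fourier k t := by
  simp [trigPoly]

theorem trigPoly_apply (a : ℤ →₀ ℂ) (t : AddCircle (2 * Real.pi)) :
    trigPoly a t = ∑ k ∈ a.support, a k * fourier k t := by
  simp [trigPoly, Finsupp.linearCombination_apply, Finsupp.sum]

theorem ContinuousMap.integrable_haarAddCircle {E : Type*} [NormedAddCommGroup E]
    {f : AddCircle (2 * Real.pi) → E} (hf : Continuous f) : Integrable f haarAddCircle :=
  hf.integrable_of_hasCompactSupport (HasCompactSupport.of_compactSpace f)

theorem integral_conj_fourier_mul_trigPoly (k : ℤ) (b : ℤ →₀ ℂ) :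
    ∫ t, conj (fourier k t) * trigPoly b t ∂haarAddCircle = b k := by
  induction b using Finsupp.induction_linear with
  | zero => simp
  | add f g hf hg =>
    simp only [map_add, ContinuousMap.add_apply, mul_add, Finsupp.add_apply]
    rw [integral_add, hf, hg] <;>
    exact ContinuousMap.integrable_haarAddCircle (by fun_prop)
  | single n c =>
    have h := congrFun (fourierCoeff_fourier (T := 2 * Real.pi) n) k
    simp only [fourierCoeff, fourier_neg, smul_eq_mul] at h
    simp only [trigPoly_single, mul_left_comm _ c]
    rw [integral_const_mul, h, Finsupp.single_apply, Pi.single_apply]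
    simp [eq_comm]

theorem integral_conj_trigPoly_mul_trigPoly (a b : ℤ →₀ ℂ) :
    ∫ t, conj (trigPoly a t) * trigPoly b t ∂haarAddCircle = ∑ k ∈ a.support, conj (a k) * b k := by
  simp only [trigPoly_apply a, map_sum, map_mul, Finset.sum_mul, mul_assoc]
  rw [integral_finsetSum]
  · simp only [integral_const_mul, integral_conj_fourier_mul_trigPoly]
  · exact fun k _ => ContinuousMap.integrable_haarAddCircle (by fun_prop)

theorem support_rieszProj (a : ℤ →₀ ℂ) :
    (rieszProj a).support = a.support.filter (fun n => 0 ≤ n) := rfl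

theorem integral_conj_rieszProj (a b : ℤ →₀ ℂ) :
    ∫ t, conj (trigPoly (rieszProj a) t) * trigPoly b t ∂haarAddCircle =
      ∫ t, conj (trigPoly a t) * trigPoly (rieszProj b) t ∂haarAddCircle := by
  simp only [integral_conj_trigPoly_mul_trigPoly, support_rieszProj, Finset.sum_filter]
  refine Finset.sum_congr rfl fun k _ => ?_
  simp only [rieszProj_apply]
  split_ifs <;> simp

theorem integral_norm_sq_trigPoly (a : ℤ →₀ ℂ) :
    ∫ t, ‖trigPoly a t‖ ^ 2 ∂haarAddCircle = ∑ k ∈ a.support, ‖a k‖ ^ 2 := by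
  have h := integral_conj_trigPoly_mul_trigPoly a a
  simp only [← Complex.normSq_eq_conj_mul_self] at h
  rw [integral_complex_ofReal] at h
  simp only [Complex.normSq_eq_norm_sq] at h
  exact_mod_cast h

theorem eLpNorm_two_rieszProj_le (a : ℤ →₀ ℂ) :
    eLpNorm (trigPoly (rieszProj a)) 2 haarAddCircle ≤ eLpNorm (trigPoly a) 2 haarAddCircle := by
  have hm : ∀ b : ℤ →₀ ℂ, eLpNorm (trigPoly b) 2 haarAddCircle =
      ENNReal.ofReal ((∑ k ∈ b.support, ‖b k‖ ^ 2) ^ (2⁻¹ : ℝ)) := fun b => by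
    rw [MemLp.eLpNorm_eq_integral_rpow_norm (by norm_num) (by norm_num)
      ((trigPoly b).continuous.memLp_of_hasCompactSupport (HasCompactSupport.of_compactSpace _))]
    rw [← integral_norm_sq_trigPoly]
    simp
  rw [hm, hm]
  gcongr
  rw [support_rieszProj, Finset.sum_filter]
  refine Finset.sum_le_sum fun k _ => ?_
  rw [rieszProj_apply]
  split_ifs <;> simp

theorem exists_trigPoly_eq_conj (a : ℤ →₀ ℂ) :
    ∃ b : ℤ →₀ ℂ, ∀ t, trigPoly b t = conj (trigPoly a t) := by
  induction a using Finsupp.induction_linear with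
  | zero => exact ⟨0, by simp⟩
  | add f g hf hg =>
    obtain ⟨b, hb⟩ := hf
    obtain ⟨c, hc⟩ := hg
    exact ⟨b + c, fun t => by simp [hb, hc]⟩
  | single n c =>
    exact ⟨Finsupp.single (-n) (conj c), fun t => by simp [trigPoly_single]⟩

theorem exists_trigPoly_approx (f : C(AddCircle (2 * Real.pi), ℂ)) {ε : ℝ} (hε : 0 < ε) :
    ∃ a : ℤ →₀ ℂ, ∀ t, ‖trigPoly a t - f t‖ ≤ ε := by
  have h : f ∈ closure (Submodule.span ℂ (Set.range (@fourier (2 * Real.pi))) :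
      Set C(AddCircle (2 * Real.pi), ℂ)) := by
    rw [← Submodule.topologicalClosure_coe, span_fourier_closure_eq_top]
    trivial
  obtain ⟨g, hg, hfg⟩ := Metric.mem_closure_iff.mp h ε hε
  rw [SetLike.mem_coe, Finsupp.mem_span_range_iff_exists_finsupp] at hg
  obtain ⟨a, rfl⟩ := hg
  refine ⟨a, fun t => ?_⟩
  rw [dist_comm] at hfg
  have h2 := (ContinuousMap.dist_apply_le_dist t).trans hfg.le
  rw [dist_eq_norm] at h2
  exact h2

theorem exists_norm_rpow_le_re_rpow_sub {p : ℝ} (hp : 1 < p) (hp2 : p ≤ 2) :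
    ∃ A B : ℝ, 0 ≤ A ∧ 0 ≤ B ∧ ∀ z : ℂ, 0 < z.re →
      ‖z‖ ^ p ≤ A * z.re ^ p - B * (z ^ (p : ℂ)).re := by
  have hp0 : 0 < p := by linarith
  have hπ := Real.pi_pos
  set φ : ℝ := Real.pi * (p + 1) / (4 * p) with hφ
  have hpφ : p * φ = Real.pi * (p + 1) / 4 := by rw [hφ]; field_simp
  have hφ0 : 0 < φ := by positivity
  have hφ1 : φ < Real.pi / 2 := by
    rw [hφ, div_lt_div_iff₀ (by positivity) (by norm_num)]
    nlinarith
  have hcφ : 0 < Real.cos φ := Real.cos_pos_of_mem_Ioo ⟨by linarith, hφ1⟩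
  have hc : Real.cos (p * φ) < 0 := by
    rw [hpφ]
    apply Real.cos_neg_of_pi_div_two_lt_of_lt <;> nlinarith
  set c := -Real.cos (p * φ) with hcdef
  have hc0 : 0 < c := by linarith
  have hcp : 0 < Real.cos φ ^ p := Real.rpow_pos_of_pos hcφ p
  have key : ∀ θ : ℝ, |θ| < Real.pi / 2 →
      1 ≤ (1 + c⁻¹) / Real.cos φ ^ p * Real.cos θ ^ p - c⁻¹ * Real.cos (p * θ) := by
    intro θ hθ
    have hcos : Real.cos θ = Real.cos |θ| := (Real.cos_abs θ).symm
    have hcosp : Real.cos (p * θ) = Real.cos (p * |θ|) := by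
      rw [← Real.cos_abs (p * θ), abs_mul, abs_of_pos hp0]
    rw [hcos, hcosp]
    have h0 := abs_nonneg θ
    have hpos : 0 ≤ Real.cos |θ| := Real.cos_nonneg_of_mem_Icc ⟨by linarith, hθ.le⟩
    rcases le_or_gt φ |θ| with h | h
    · have h1 : Real.cos (p * |θ|) ≤ -c := by
        rw [hcdef, neg_neg]
        exact Real.cos_le_cos_of_nonneg_of_le_pi (by positivity) (by nlinarith)
          (mul_le_mul_of_nonneg_left h hp0.le)
      have h2 : c⁻¹ * Real.cos (p * |θ|) ≤ c⁻¹ * -c :=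
        mul_le_mul_of_nonneg_left h1 (by positivity)
      have h3 : c⁻¹ * -c = -1 := by field_simp
      have h4 : 0 ≤ (1 + c⁻¹) / Real.cos φ ^ p * Real.cos |θ| ^ p := by positivity
      linarith
    · have h1 : Real.cos φ ≤ Real.cos |θ| :=
        Real.cos_le_cos_of_nonneg_of_le_pi h0 (by linarith) h.le
      have h2 : Real.cos φ ^ p ≤ Real.cos |θ| ^ p := Real.rpow_le_rpow hcφ.le h1 hp0.le
      have h3 : (1 + c⁻¹) ≤ (1 + c⁻¹) / Real.cos φ ^ p * Real.cos |θ| ^ p := by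
        rw [div_mul_eq_mul_div, le_div_iff₀ hcp]
        gcongr
      have h4 : c⁻¹ * Real.cos (p * |θ|) ≤ c⁻¹ * 1 :=
        mul_le_mul_of_nonneg_left (Real.cos_le_one _) (by positivity)
      linarith
  refine ⟨(1 + c⁻¹) / Real.cos φ ^ p, c⁻¹, by positivity, by positivity, fun z hz => ?_⟩
  have hk := key _ (Complex.abs_arg_lt_pi_div_two_iff.mpr (Or.inl hz))
  have hre : z.re = ‖z‖ * Real.cos z.arg := (Complex.norm_mul_cos_arg z).symm
  have hcosz : 0 ≤ Real.cos z.arg :=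
    Real.cos_nonneg_of_neg_pi_div_two_le_of_le
      (abs_lt.mp (Complex.abs_arg_lt_pi_div_two_iff.mpr (Or.inl hz))).1.le
      (abs_lt.mp (Complex.abs_arg_lt_pi_div_two_iff.mpr (Or.inl hz))).2.le
  rw [Complex.cpow_ofReal_re, hre, Real.mul_rpow (norm_nonneg z) hcosz, mul_comm z.arg p]
  have := mul_le_mul_of_nonneg_left hk (Real.rpow_nonneg (norm_nonneg z) p)
  linarith

theorem integral_comp_fourier_one {E : Type*} [NormedAddCommGroup E] [NormedSpace ℝ E]
    (h : ℂ → E) :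
    ∫ t : AddCircle (2 * Real.pi), h (fourier 1 t) ∂haarAddCircle =
      Real.circleAverage h 0 1 := by
  rw [AddCircle.integral_haarAddCircle, Real.circleAverage,
    ← AddCircle.intervalIntegral_preimage (2 * Real.pi) 0]
  simp [toCircle, circleMap]

theorem coeff_zero_eq_integral (a : ℤ →₀ ℂ) : a 0 = ∫ t, trigPoly a t ∂haarAddCircle := by
  rw [← integral_conj_fourier_mul_trigPoly]
  simp

theorem coeff_neg_of_im_eq_zero {a : ℤ →₀ ℂ} (ha : ∀ t, (trigPoly a t).im = 0) (k : ℤ) :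
    a (-k) = conj (a k) := by
  rw [← integral_conj_fourier_mul_trigPoly, ← integral_conj_fourier_mul_trigPoly,
    ← integral_conj]
  congr 1
  ext t
  rw [map_mul, Complex.conj_eq_iff_im.mpr (ha t), fourier_neg]

theorem fourier_eq_fourier_one_pow {k : ℤ} (hk : 0 ≤ k) (t : AddCircle (2 * Real.pi)) :
    fourier k t = fourier 1 t ^ k.toNat := by
  lift k to ℕ using hk
  simp [fourier_apply, AddCircle.toCircle_nsmul]

/-- If a trigonometric polynomial is real valued and at least `δ` then it is the real part on
the circle of an entire function whose real part is at least `δ` on the unit disc. -/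
theorem exists_entire_of_pos {a : ℤ →₀ ℂ} {δ : ℝ}
    (ha : ∀ t, (trigPoly a t).im = 0 ∧ δ ≤ (trigPoly a t).re) :
    ∃ G : ℂ → ℂ, Differentiable ℂ G ∧ (∀ z ∈ closedBall (0 : ℂ) 1, δ ≤ (G z).re) ∧
      G 0 = a 0 ∧ (∀ t, G (fourier 1 t) = 2 * trigPoly (rieszProj a) t - a 0) ∧
      ∀ t, ((G (fourier 1 t)).re : ℂ) = trigPoly a t := by
  set G : ℂ → ℂ := fun z => 2 * ∑ k ∈ (rieszProj a).support, a k * z ^ k.toNat - a 0 with hG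
  have hdiff : Differentiable ℂ G := by fun_prop
  have hG1 : ∀ t, G (fourier 1 t) = 2 * trigPoly (rieszProj a) t - a 0 := by
    intro t
    simp only [hG, trigPoly_apply]
    congr 2
    refine Finset.sum_congr rfl fun k hk => ?_
    rw [support_rieszProj, Finset.mem_filter] at hk
    rw [rieszProj_apply, if_pos hk.2, fourier_eq_fourier_one_pow hk.2]
  have hneg := coeff_neg_of_im_eq_zero fun t => (ha t).1
  have h00 : conj (a 0) = a 0 := by simpa using (hneg 0).symm
  have hG2 : ∀ t, ((G (fourier 1 t)).re : ℂ) = trigPoly a t := by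
    intro t
    have h1 : conj (trigPoly (rieszProj a) t) =
        ∑ k ∈ a.support, if k ≤ 0 then a k * fourier k t else 0 := by
      rw [trigPoly_apply, support_rieszProj, Finset.sum_filter, map_sum]
      refine Finset.sum_nbij' (fun k => -k) (fun k => -k) ?_ ?_ (by simp) (by simp) ?_
      · intro k hk; simpa [hneg] using hk
      · intro k hk; simpa [hneg] using hk
      · intro k _
        by_cases hk : 0 ≤ k
        · simp [hk, rieszProj_apply, hneg]
        · simp [hk]
    have h2 : trigPoly (rieszProj a) t =
        ∑ k ∈ a.support, if 0 ≤ k then a k * fourier k t else 0 := by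
      rw [trigPoly_apply, support_rieszProj, Finset.sum_filter]
      refine Finset.sum_congr rfl fun k _ => ?_
      split_ifs with h
      · rw [rieszProj_apply, if_pos h]
      · rfl
    have h3 : a 0 = ∑ k ∈ a.support, if k = 0 then a k * fourier k t else 0 := by
      rw [Finset.sum_ite_eq']
      split_ifs with h
      · simp
      · simpa using h
    rw [Complex.re_eq_add_conj, hG1, map_sub, map_mul, h00, h1]
    have h4 : (∑ k ∈ a.support, if 0 ≤ k then a k * fourier k t else 0) +
        (∑ k ∈ a.support, if k ≤ 0 then a k * fourier k t else 0) = trigPoly a t +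
        ∑ k ∈ a.support, if k = 0 then a k * fourier k t else 0 := by
      rw [trigPoly_apply, ← Finset.sum_add_distrib, ← Finset.sum_add_distrib]
      refine Finset.sum_congr rfl fun k _ => ?_
      rcases lt_trichotomy k 0 with h | h | h
      · simp [h.le, h.ne, not_le.mpr h]
      · simp [h]
      · simp [h.le, h.ne', not_le.mpr h]
    rw [← h2, ← h3] at h4
    have h5 : conj (2 : ℂ) = 2 := Complex.conj_ofNat 2
    rw [h5]
    linear_combination h4
  refine ⟨G, hdiff, fun z hz => ?_, ?_, hG1, hG2⟩
  · have hfr : ∀ w ∈ frontier (ball (0 : ℂ) 1), ‖Complex.exp (-G w)‖ ≤ Real.exp (-δ) := by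
      intro w hw
      rw [frontier_ball _ one_ne_zero, mem_sphere_zero_iff_norm] at hw
      obtain ⟨t, rfl⟩ : ∃ t : AddCircle (2 * Real.pi), fourier 1 t = w := by
        refine ⟨(Complex.arg w : AddCircle (2 * Real.pi)), ?_⟩
        rw [fourier_coe_apply]
        have h := Complex.norm_mul_exp_arg_mul_I w
        rw [hw] at h
        simp only [Complex.ofReal_one, one_mul] at h
        nth_rewrite 2 [← h]
        congr 1
        have : (Real.pi : ℂ) ≠ 0 := by exact_mod_cast Real.pi_ne_zero
        push_cast
        field_simp
      rw [Complex.norm_exp, Complex.neg_re]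
      have h := congrArg Complex.re (hG2 t)
      rw [Complex.ofReal_re] at h
      rw [h]
      exact Real.exp_le_exp.mpr (neg_le_neg (ha t).2)
    have h := Complex.norm_le_of_forall_mem_frontier_norm_le isBounded_ball
      (hdiff.neg.cexp.diffContOnCl) hfr (by rwa [closure_ball _ one_ne_zero])
    rw [Complex.norm_exp, Pi.neg_apply, Complex.neg_re] at h
    exact neg_le_neg_iff.mp (Real.exp_le_exp.mp h)
  · simp only [hG]
    have : ∑ k ∈ (rieszProj a).support, a k * (0 : ℂ) ^ k.toNat = a 0 := by
      rw [support_rieszProj, Finset.sum_filter,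
        ← show (∑ k ∈ a.support, if k = 0 then a k else 0) = a 0 by
          rw [Finset.sum_ite_eq']; split_ifs with h <;> simp_all]
      refine Finset.sum_congr rfl fun k _ => ?_
      rcases lt_trichotomy k 0 with h | h | h
      · simp [h.ne, not_le.mpr h]
      · simp [h]
      · have : k.toNat ≠ 0 := by omega
        simp [h.le, h.ne', this]
    rw [this]
    ring

theorem memLp_trigPoly (a : ℤ →₀ ℂ) (p : ℝ≥0∞) : MemLp (trigPoly a) p haarAddCircle :=
  (trigPoly a).continuous.memLp_of_hasCompactSupport (HasCompactSupport.of_compactSpace _)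

theorem eLpNorm_trigPoly {p : ℝ} (hp : 0 < p) (a : ℤ →₀ ℂ) :
    eLpNorm (trigPoly a) (ENNReal.ofReal p) haarAddCircle =
      ENNReal.ofReal ((∫ t, ‖trigPoly a t‖ ^ p ∂haarAddCircle) ^ p⁻¹) := by
  rw [MemLp.eLpNorm_eq_integral_rpow_norm (by simpa using hp) ENNReal.ofReal_ne_top
    (memLp_trigPoly a _), ENNReal.toReal_ofReal hp.le]

theorem enorm_coeff_zero_le {p : ℝ} (hp : 1 ≤ p) (a : ℤ →₀ ℂ) :
    ‖a 0‖ₑ ≤ eLpNorm (trigPoly a) (ENNReal.ofReal p) haarAddCircle := by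
  rw [coeff_zero_eq_integral]
  refine (enorm_integral_le_lintegral_enorm _).trans ?_
  rw [← eLpNorm_one_eq_lintegral_enorm]
  exact eLpNorm_le_eLpNorm_of_exponent_le (by simpa using hp)
    (memLp_trigPoly a 1).aestronglyMeasurable

/-- The Riesz projection is bounded in `L^p`, `1 < p ≤ 2`, on positive trigonometric
polynomials. -/
theorem exists_eLpNorm_rieszProj_le_of_pos {p : ℝ} (hp : 1 < p) (hp2 : p ≤ 2) :
    ∃ C : ℝ≥0, ∀ (a : ℤ →₀ ℂ) (δ : ℝ), 0 < δ →
      (∀ t, (trigPoly a t).im = 0 ∧ δ ≤ (trigPoly a t).re) →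
      eLpNorm (trigPoly (rieszProj a)) (ENNReal.ofReal p) haarAddCircle ≤
        C * eLpNorm (trigPoly a) (ENNReal.ofReal p) haarAddCircle := by
  obtain ⟨A, B, hA, hB, hAB⟩ := exists_norm_rpow_le_re_rpow_sub hp hp2
  have hp0 : 0 < p := by linarith
  refine ⟨Real.toNNReal (A ^ p⁻¹) + 1, fun a δ hδ ha => ?_⟩
  obtain ⟨G, hGd, hGre, hG0, hGP, hGf⟩ := exists_entire_of_pos ha
  set f := eLpNorm (trigPoly a) (ENNReal.ofReal p) haarAddCircle with hf
  have hpos : ∀ t : AddCircle (2 * Real.pi), δ ≤ (G (fourier 1 t)).re := fun t => by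
    have h := congrArg Complex.re (hGf t)
    rw [Complex.ofReal_re] at h
    rw [h]
    exact (ha t).2
  have hGc : Continuous fun t : AddCircle (2 * Real.pi) => G (fourier 1 t) :=
    hGd.continuous.comp (fourier 1).continuous
  have hslit : ∀ t : AddCircle (2 * Real.pi), G (fourier 1 t) ∈ slitPlane := fun t =>
    Or.inl (hδ.trans_le (hpos t))
  have hmean : ∫ t : AddCircle (2 * Real.pi), G (fourier 1 t) ^ (p : ℂ) ∂haarAddCircle =
      a 0 ^ (p : ℂ) := by
    rw [integral_comp_fourier_one (fun z => G z ^ (p : ℂ)), ← hG0]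
    have hd : DifferentiableOn ℂ (fun z => G z ^ (p : ℂ)) (closedBall 0 1) := fun z hz =>
      (hGd z).differentiableWithinAt.cpow (differentiableWithinAt_const _)
        (Or.inl (hδ.trans_le (hGre z hz)))
    refine DiffContOnCl.circleAverage (f := fun z => G z ^ (p : ℂ)) (R := 1) (c := 0) ?_
    rw [abs_one]
    exact (closure_ball (0 : ℂ) one_ne_zero ▸ hd).diffContOnCl
  have ha0 : 0 ≤ (a 0 ^ (p : ℂ)).re := by
    have h1 : conj (a 0) = a 0 := by
      simpa using (coeff_neg_of_im_eq_zero (fun t => (ha t).1) 0).symm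
    have h2 : 0 ≤ (a 0).re := by
      rw [← hG0]
      exact hδ.le.trans (hGre 0 (by simp))
    rw [← Complex.conj_eq_iff_re.mp h1, ← Complex.ofReal_cpow h2, Complex.ofReal_re]
    exact Real.rpow_nonneg h2 p
  have hint : ∫ t : AddCircle (2 * Real.pi), ‖G (fourier 1 t)‖ ^ p ∂haarAddCircle ≤
      A * ∫ t, ‖trigPoly a t‖ ^ p ∂haarAddCircle := by
    have hcp : Continuous fun t : AddCircle (2 * Real.pi) => G (fourier 1 t) ^ (p : ℂ) :=
      hGc.cpow continuous_const hslit
    have hc1 : Continuous fun t => ‖trigPoly a t‖ ^ p :=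
      (trigPoly a).continuous.norm.rpow_const fun _ => Or.inr hp0.le
    calc ∫ t : AddCircle (2 * Real.pi), ‖G (fourier 1 t)‖ ^ p ∂haarAddCircle
        ≤ ∫ t : AddCircle (2 * Real.pi), (A * ‖trigPoly a t‖ ^ p -
            B * (G (fourier 1 t) ^ (p : ℂ)).re) ∂haarAddCircle := by
          refine integral_mono
            (ContinuousMap.integrable_haarAddCircle
              (hGc.norm.rpow_const fun _ => Or.inr hp0.le))
            (ContinuousMap.integrable_haarAddCircle (by fun_prop)) fun t => ?_
          have h := hAB _ (hδ.trans_le (hpos t))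
          rw [← hGf, Complex.norm_real, Real.norm_of_nonneg (hδ.le.trans (hpos t))]
          exact h
      _ = A * ∫ t, ‖trigPoly a t‖ ^ p ∂haarAddCircle - B * (a 0 ^ (p : ℂ)).re := by
          rw [integral_sub (ContinuousMap.integrable_haarAddCircle (by fun_prop))
            (ContinuousMap.integrable_haarAddCircle (by fun_prop)), integral_const_mul,
            integral_const_mul, ← hmean]
          congr 2
          exact integral_re (ContinuousMap.integrable_haarAddCircle hcp)
      _ ≤ _ := by nlinarith
  have hGnorm : eLpNorm (fun t : AddCircle (2 * Real.pi) => G (fourier 1 t))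
      (ENNReal.ofReal p) haarAddCircle ≤ ENNReal.ofReal (A ^ p⁻¹) * f := by
    rw [hf, eLpNorm_trigPoly hp0, MemLp.eLpNorm_eq_integral_rpow_norm (by simpa using hp0)
      ENNReal.ofReal_ne_top (hGc.memLp_of_hasCompactSupport (HasCompactSupport.of_compactSpace _)),
      ENNReal.toReal_ofReal hp0.le, ← ENNReal.ofReal_mul (by positivity),
      ← Real.mul_rpow hA (by positivity)]
    gcongr
  have heq : ⇑(trigPoly (rieszProj a)) =
      (2⁻¹ : ℂ) • ((fun t : AddCircle (2 * Real.pi) => G (fourier 1 t)) + fun _ => a 0) := by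
    ext t
    simp only [Pi.smul_apply, Pi.add_apply, hGP, smul_eq_mul]
    ring
  have hp1 : (1 : ℝ≥0∞) ≤ ENNReal.ofReal p := by simpa using hp.le
  rw [heq, eLpNorm_const_smul]
  have h2 : ‖(2⁻¹ : ℂ)‖ₑ ≤ 1 := by
    rw [← ofReal_norm, ENNReal.ofReal_le_one]
    norm_num
  calc _ ≤ 1 * (ENNReal.ofReal (A ^ p⁻¹) * f + f) := by
        gcongr
        refine (eLpNorm_add_le hGc.aestronglyMeasurable aestronglyMeasurable_const hp1).trans ?_
        gcongr
        refine le_trans (le_of_eq ?_) (enorm_coeff_zero_le hp.le a)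
        rw [eLpNorm_const _ (by simpa using hp0) (NeZero.ne _)]
        simp
    _ = _ := by
        rw [one_mul, ENNReal.coe_add, ENNReal.coe_one, add_mul, one_mul]
        rfl

theorem exists_pos_trigPoly_approx {h : AddCircle (2 * Real.pi) → ℝ} (hc : Continuous h)
    (h0 : ∀ t, 0 ≤ h t) {ε : ℝ} (hε : 0 < ε) :
    ∃ a : ℤ →₀ ℂ, (∀ t, (trigPoly a t).im = 0 ∧ ε ≤ (trigPoly a t).re) ∧
      ∀ t, ‖trigPoly a t - h t‖ ≤ 3 * ε := by
  obtain ⟨b, hb⟩ := exists_trigPoly_approx ⟨fun t => ((h t + 2 * ε : ℝ) : ℂ), by fun_prop⟩ hε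
  obtain ⟨b', hb'⟩ := exists_trigPoly_eq_conj b
  have key : ∀ t, trigPoly ((2⁻¹ : ℂ) • (b + b')) t = ((trigPoly b t).re : ℂ) := fun t => by
    rw [map_smul, map_add, ContinuousMap.smul_apply, ContinuousMap.add_apply, hb', smul_eq_mul,
      Complex.re_eq_add_conj]
    ring
  have hbre : ∀ t, |(trigPoly b t).re - (h t + 2 * ε)| ≤ ε := fun t => by
    have h := (Complex.abs_re_le_norm _).trans (hb t)
    simpa using h
  refine ⟨(2⁻¹ : ℂ) • (b + b'), fun t => ?_, fun t => ?_⟩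
  · rw [key, Complex.ofReal_im, Complex.ofReal_re]
    have := abs_le.mp (hbre t)
    exact ⟨rfl, by linarith [h0 t]⟩
  · rw [key, ← Complex.ofReal_sub, Complex.norm_real, Real.norm_eq_abs, abs_le]
    have := abs_le.mp (hbre t)
    constructor <;> linarith

/-- The Riesz projection is bounded in `L^p` for `1 < p ≤ 2`. -/
theorem exists_eLpNorm_rieszProj_le_of_le_two {p : ℝ} (hp : 1 < p) (hp2 : p ≤ 2) :
    ∃ C : ℝ≥0, ∀ a : ℤ →₀ ℂ,
      eLpNorm (trigPoly (rieszProj a)) (ENNReal.ofReal p) haarAddCircle ≤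
        C * eLpNorm (trigPoly a) (ENNReal.ofReal p) haarAddCircle := by
  obtain ⟨C, hC⟩ := exists_eLpNorm_rieszProj_le_of_pos hp hp2
  have hp0 : 0 < p := by linarith
  have hp1 : (1 : ℝ≥0∞) ≤ ENNReal.ofReal p := by simpa using hp.le
  have hsmall : ∀ {f : AddCircle (2 * Real.pi) → ℂ} {c : ℝ} (q : ℝ≥0∞),
      (∀ t, ‖f t‖ ≤ c) → eLpNorm f q haarAddCircle ≤ ENNReal.ofReal c := fun {f c} q hf => by
    refine (eLpNorm_le_of_ae_bound (Filter.Eventually.of_forall hf)).trans ?_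
    simp
  refine ⟨4 * C, fun a => ?_⟩
  set f := eLpNorm (trigPoly a) (ENNReal.ofReal p) haarAddCircle with hf
  set h : Fin 4 → AddCircle (2 * Real.pi) → ℝ :=
    fun j t => max ((-I) ^ (j : ℕ) * trigPoly a t).re 0 with hh
  have hhc : ∀ j, Continuous (h j) := fun j => by fun_prop
  have hhle : ∀ j t, ‖(h j t : ℂ)‖ ≤ ‖trigPoly a t‖ := fun j t => by
    rw [Complex.norm_real, Real.norm_of_nonneg (le_max_right _ _)]
    refine max_le ((Complex.re_le_norm _).trans (by simp)) (norm_nonneg _)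
  have hsum : ∀ t, ∑ j : Fin 4, I ^ (j : ℕ) * (h j t : ℂ) = trigPoly a t := fun t => by
    have hmax : ∀ x : ℝ, max x 0 - max (-x) 0 = x := fun x => by
      rcases le_total x 0 with hx | hx
      · rw [max_eq_right hx, max_eq_left (by linarith)]; ring
      · rw [max_eq_left hx, max_eq_right (by linarith)]; ring
    have h1 := hmax (trigPoly a t).re
    have h2 := hmax (trigPoly a t).im
    apply Complex.ext <;> simp [Fin.sum_univ_four, hh, pow_succ] <;> linarith
  have key : ∀ ε : ℝ, 0 < ε →
      eLpNorm (trigPoly (rieszProj a)) (ENNReal.ofReal p) haarAddCircle ≤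
        4 * C * f + ENNReal.ofReal ((12 * C + 12) * ε) := by
    intro ε hε
    choose b hb hbh using fun j => exists_pos_trigPoly_approx (hhc j) (fun t => le_max_right _ _) hε
    set g : ℤ →₀ ℂ := ∑ j, I ^ (j : Fin 4).val • b j with hg
    have h1 : ∀ t, ‖trigPoly (a - g) t‖ ≤ 12 * ε := fun t => by
      have : trigPoly (a - g) t = ∑ j, I ^ (j : Fin 4).val * ((h j t : ℂ) - trigPoly (b j) t) := by
        simp only [mul_sub, Finset.sum_sub_distrib, hsum]
        simp [hg]
      rw [this]
      refine (norm_sum_le _ _).trans ?_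
      refine (Finset.sum_le_sum (g := fun _ => 3 * ε) fun j _ => ?_).trans ?_
      · rw [norm_mul, norm_pow, Complex.norm_I, one_pow, one_mul, norm_sub_rev]
        exact hbh j t
      · simp; linarith
    have h2 : eLpNorm (trigPoly (rieszProj (a - g))) (ENNReal.ofReal p) haarAddCircle ≤
        ENNReal.ofReal (12 * ε) :=
      (eLpNorm_le_eLpNorm_of_exponent_le (by simpa using hp2)
        (memLp_trigPoly _ 1).aestronglyMeasurable).trans
        ((eLpNorm_two_rieszProj_le _).trans (hsmall 2 h1))
    have h3 : ∀ j, eLpNorm (trigPoly (rieszProj (b j))) (ENNReal.ofReal p) haarAddCircle ≤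
        C * (f + ENNReal.ofReal (3 * ε)) := fun j => by
      refine (hC (b j) ε hε (hb j)).trans ?_
      gcongr
      have : ⇑(trigPoly (b j)) = (fun t => (h j t : ℂ)) + fun t => trigPoly (b j) t - h j t := by
        ext t; simp
      rw [this]
      refine (eLpNorm_add_le (by fun_prop) (by fun_prop) hp1).trans ?_
      exact add_le_add (eLpNorm_mono (hhle j)) (hsmall _ (hbh j))
    have h4 : ⇑(trigPoly (rieszProj a)) = ⇑(trigPoly (rieszProj (a - g))) +
        ∑ j, I ^ (j : Fin 4).val • ⇑(trigPoly (rieszProj (b j))) := by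
      ext t
      simp [hg]
    rw [h4]
    refine (eLpNorm_add_le (by fun_prop) ?_ hp1).trans ?_
    · exact Finset.aestronglyMeasurable_sum _ fun j _ =>
        (memLp_trigPoly _ 1).aestronglyMeasurable.const_smul _
    refine (add_le_add h2 (eLpNorm_sum_le (fun j _ =>
        (memLp_trigPoly _ 1).aestronglyMeasurable.const_smul _) hp1)).trans ?_
    refine (add_le_add le_rfl (Finset.sum_le_sum
      (g := fun _ => C * (f + ENNReal.ofReal (3 * ε))) fun j _ => ?_)).trans (le_of_eq ?_)
    · rw [eLpNorm_const_smul]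
      simpa [← ofReal_norm] using h3 j
    · have e1 : ENNReal.ofReal ((12 * C + 12) * ε) = 4 * C * ENNReal.ofReal (3 * ε) +
          ENNReal.ofReal (12 * ε) := by
        rw [← ENNReal.ofReal_coe_nnreal, show (4 : ℝ≥0∞) = ENNReal.ofReal 4 by simp,
          ← ENNReal.ofReal_mul (by norm_num), ← ENNReal.ofReal_mul (by positivity),
          ← ENNReal.ofReal_add (by positivity) (by positivity)]
        congr 1
        ring
      rw [e1]
      simp
      ring
  rw [ENNReal.coe_mul]
  refine ENNReal.le_of_forall_pos_le_add fun ε hε _ => ?_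
  refine (key (ε / (12 * C + 12)) (by positivity)).trans (le_of_eq ?_)
  rw [mul_div_cancel₀ _ (by positivity)]
  simp

/-- The Riesz projection is bounded in `L^p` for `2 < p < ∞`, by duality. -/
theorem exists_eLpNorm_rieszProj_le_of_two_lt {p : ℝ} (hp : 2 < p) :
    ∃ C : ℝ≥0, ∀ a : ℤ →₀ ℂ,
      eLpNorm (trigPoly (rieszProj a)) (ENNReal.ofReal p) haarAddCircle ≤
        C * eLpNorm (trigPoly a) (ENNReal.ofReal p) haarAddCircle := by
  have hpq : p.HolderConjugate p.conjExponent := Real.HolderConjugate.conjExponent (by linarith)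
  set q := p.conjExponent with hq
  have hp0 : 0 < p := by linarith
  have hq0 : 0 < q := hpq.symm.pos
  have hq2 : q ≤ 2 := by
    rw [hq, Real.conjExponent, div_le_iff₀ (by linarith)]
    linarith
  obtain ⟨C, hC⟩ := exists_eLpNorm_rieszProj_le_of_le_two hpq.symm.lt hq2
  refine ⟨C, fun a => ?_⟩
  set h := trigPoly (rieszProj a) with hh
  set F : ℝ := (∫ t, ‖trigPoly a t‖ ^ p ∂haarAddCircle) ^ p⁻¹ with hF
  set X : ℝ := ∫ t, ‖h t‖ ^ p ∂haarAddCircle with hX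
  set H : ℝ := ∫ t, ‖h t‖ ∂haarAddCircle with hH
  have hX0 : 0 ≤ X := integral_nonneg fun t => by positivity
  have hH0 : 0 ≤ H := integral_nonneg fun t => by positivity
  have hF0 : 0 ≤ F := Real.rpow_nonneg (integral_nonneg fun t => by positivity) _
  let g : C(AddCircle (2 * Real.pi), ℂ) := ⟨fun t => ((‖h t‖ ^ (p - 2) : ℝ) : ℂ) * h t, by
    refine (Complex.continuous_ofReal.comp ?_).mul h.continuous
    exact h.continuous.norm.rpow_const fun _ => Or.inr (by linarith)⟩
  have hgnorm : ∀ t, ‖g t‖ = ‖h t‖ ^ (p - 1) := fun t => by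
    have : ‖g t‖ = ‖h t‖ ^ (p - 2) * ‖h t‖ := by
      simp only [g, ContinuousMap.coe_mk, norm_mul, Complex.norm_real]
      rw [Real.norm_of_nonneg (by positivity)]
    rw [this, ← Real.rpow_add_one' (norm_nonneg _) (by linarith)]
    congr 1
    ring
  have hgq : ∀ t, ‖g t‖ ^ q = ‖h t‖ ^ p := fun t => by
    rw [hgnorm, ← Real.rpow_mul (norm_nonneg _), hpq.sub_one_mul_conj]
  have hhg : ∀ t, conj (h t) * g t = ((‖h t‖ ^ p : ℝ) : ℂ) := fun t => by
    simp only [g, ContinuousMap.coe_mk]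
    rw [mul_left_comm, ← Complex.normSq_eq_conj_mul_self, ← Complex.ofReal_mul,
      Complex.normSq_eq_norm_sq, ← Real.rpow_two, ← Real.rpow_add' (norm_nonneg _) (by linarith)]
    congr 2
    ring
  have hgL : eLpNorm g (ENNReal.ofReal q) haarAddCircle = ENNReal.ofReal (X ^ q⁻¹) := by
    rw [MemLp.eLpNorm_eq_integral_rpow_norm (by simpa using hq0) ENNReal.ofReal_ne_top
      (g.continuous.memLp_of_hasCompactSupport (HasCompactSupport.of_compactSpace _)),
      ENNReal.toReal_ofReal hq0.le]
    simp only [hgq, hX]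
  have hmem : ∀ (b : ℤ →₀ ℂ) (r : ℝ≥0∞), MemLp (fun t => ‖trigPoly b t‖) r haarAddCircle :=
    fun b r => (memLp_trigPoly b r).norm
  have key : ∀ ε : ℝ, 0 < ε → X ≤ F * (C * (X ^ q⁻¹ + ε)) + ε * H := fun ε hε => by
    obtain ⟨b, hb⟩ := exists_trigPoly_approx g hε
    have hY : (∫ t, ‖trigPoly (rieszProj b) t‖ ^ q ∂haarAddCircle) ^ q⁻¹ ≤
        C * (X ^ q⁻¹ + ε) := by
      rw [← ENNReal.ofReal_le_ofReal_iff (by positivity), ← eLpNorm_trigPoly hq0]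
      refine (hC b).trans ?_
      rw [ENNReal.ofReal_mul (by positivity), ENNReal.ofReal_coe_nnreal,
        ENNReal.ofReal_add (by positivity) hε.le, ← hgL]
      gcongr
      have : ⇑(trigPoly b) = ⇑g + ⇑(trigPoly b - g) := by
        ext t; simp
      rw [this]
      refine (eLpNorm_add_le (by fun_prop) (by fun_prop) (by simpa using hpq.symm.lt.le)).trans ?_
      gcongr
      refine (eLpNorm_le_of_ae_bound (C := ε) (Filter.Eventually.of_forall fun t => ?_)).trans ?_
      · simpa using hb t
      · simp
    have h1 : (X : ℂ) = ∫ t, conj (trigPoly a t) * trigPoly (rieszProj b) t ∂haarAddCircle +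
        ∫ t, conj (h t) * (g t - trigPoly b t) ∂haarAddCircle := by
      rw [← integral_conj_rieszProj, ← integral_add
        (ContinuousMap.integrable_haarAddCircle (by fun_prop))
        (ContinuousMap.integrable_haarAddCircle (by fun_prop)), hX, ← integral_complex_ofReal]
      congr 1
      ext t
      rw [← hhg]
      ring
    have h2 : ‖∫ t, conj (trigPoly a t) * trigPoly (rieszProj b) t ∂haarAddCircle‖ ≤
        F * (C * (X ^ q⁻¹ + ε)) := by
      refine (norm_integral_le_integral_norm _).trans ?_
      simp only [norm_mul, RCLike.norm_conj]
      refine (integral_mul_le_Lp_mul_Lq_of_nonneg hpq (Filter.Eventually.of_forall fun _ =>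
        norm_nonneg _) (Filter.Eventually.of_forall fun _ => norm_nonneg _)
        (hmem _ _) (hmem _ _)).trans ?_
      rw [one_div, one_div]
      exact mul_le_mul_of_nonneg_left hY hF0
    have h3 : ‖∫ t, conj (h t) * (g t - trigPoly b t) ∂haarAddCircle‖ ≤ ε * H := by
      refine (norm_integral_le_integral_norm _).trans ?_
      rw [hH, ← integral_const_mul]
      refine integral_mono (ContinuousMap.integrable_haarAddCircle (by fun_prop))
        (ContinuousMap.integrable_haarAddCircle (by fun_prop)) fun t => ?_
      simp only [norm_mul, RCLike.norm_conj]
      rw [mul_comm ‖h t‖, norm_sub_rev]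
      exact mul_le_mul_of_nonneg_right (hb t) (norm_nonneg _)
    calc X = ‖(X : ℂ)‖ := by rw [Complex.norm_real, Real.norm_of_nonneg hX0]
      _ ≤ _ := by
        rw [h1]
        exact (norm_add_le _ _).trans (add_le_add h2 h3)
  have hlim : X ≤ F * C * X ^ q⁻¹ := by
    refine le_of_forall_pos_le_add fun ε hε => ?_
    have hD : 0 < F * C + H + 1 := by positivity
    refine (key (ε / (F * C + H + 1)) (by positivity)).trans ?_
    have : ε / (F * C + H + 1) * (F * C + H) ≤ ε := by
      rw [div_mul_eq_mul_div, div_le_iff₀ hD]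
      nlinarith
    linarith
  rw [eLpNorm_trigPoly hp0, eLpNorm_trigPoly hp0, ← ENNReal.ofReal_coe_nnreal,
    ← ENNReal.ofReal_mul (by positivity)]
  apply ENNReal.ofReal_le_ofReal
  rcases hX0.eq_or_lt with h0 | h0
  · rw [← hX, ← h0, Real.zero_rpow (inv_ne_zero hp0.ne')]
    positivity
  · refine le_of_mul_le_mul_right ?_ (Real.rpow_pos_of_pos h0 q⁻¹)
    rw [← Real.rpow_add h0, hpq.inv_add_inv_eq_one, Real.rpow_one]
    linarith

/-- The M. Riesz theorem: the Riesz projection is bounded in `L^p` for `1 < p < ∞`. -/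
theorem exists_eLpNorm_rieszProj_le {p : ℝ} (hp : 1 < p) :
    ∃ C : ℝ≥0, ∀ a : ℤ →₀ ℂ,
      eLpNorm (trigPoly (rieszProj a)) (ENNReal.ofReal p) haarAddCircle ≤
        C * eLpNorm (trigPoly a) (ENNReal.ofReal p) haarAddCircle :=
  (le_or_gt p 2).elim (exists_eLpNorm_rieszProj_le_of_le_two hp)
    exists_eLpNorm_rieszProj_le_of_two_lt

/-- Partial sums of analytic trigonometric polynomials are uniformly bounded in `L^p`. -/
theorem exists_eLpNorm_partialSum_le {p : ℝ} (hp : 1 < p) :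
    ∃ C : ℝ≥0, ∀ (c : ℕ → ℂ) (M N : ℕ),
      eLpNorm (fun t : AddCircle (2 * Real.pi) =>
          ∑ d ∈ Finset.range M, if d < N then fourier 1 t ^ d * c d else 0)
          (ENNReal.ofReal p) haarAddCircle ≤
        C * eLpNorm (fun t : AddCircle (2 * Real.pi) =>
          ∑ d ∈ Finset.range M, fourier 1 t ^ d * c d) (ENNReal.ofReal p) haarAddCircle := by
  obtain ⟨C, hC⟩ := exists_eLpNorm_rieszProj_le hp
  refine ⟨1 + C, fun c M N => ?_⟩
  set a : ℤ →₀ ℂ := ∑ d ∈ Finset.range M, Finsupp.single ((d : ℤ) - N) (c d) with ha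
  have hpow : ∀ (d : ℕ) (t : AddCircle (2 * Real.pi)), fourier 1 t ^ d =
      fourier N t * fourier ((d : ℤ) - N) t := fun d t => by
    rw [← fourier_add, add_sub_cancel, fourier_eq_fourier_one_pow (Int.natCast_nonneg d),
      Int.toNat_natCast]
  have hfull : (fun t : AddCircle (2 * Real.pi) => ∑ d ∈ Finset.range M, fourier 1 t ^ d * c d) =
      fun t => fourier N t * trigPoly a t := by
    ext t
    simp only [ha, map_sum, ContinuousMap.sum_apply, trigPoly_single, Finset.mul_sum, hpow]
    exact Finset.sum_congr rfl fun d _ => by ring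
  have hlow : (fun t : AddCircle (2 * Real.pi) =>
      ∑ d ∈ Finset.range M, if d < N then fourier 1 t ^ d * c d else 0) =
      (fun t => fourier N t * trigPoly a t) -
        fun t => fourier N t * trigPoly (rieszProj a) t := by
    rw [← hfull]
    ext t
    simp only [ha, map_sum, Pi.sub_apply, rieszProj_single, ContinuousMap.sum_apply,
      Finset.mul_sum, ← Finset.sum_sub_distrib]
    refine Finset.sum_congr rfl fun d _ => ?_
    split_ifs with h1 h2 h2
    · omega
    · simp
    · rw [trigPoly_single, hpow]
      ring
    · omega
  have hnorm : ∀ b : ℤ →₀ ℂ, eLpNorm (fun t => fourier N t * trigPoly b t) (ENNReal.ofReal p)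
      haarAddCircle = eLpNorm (trigPoly b) (ENNReal.ofReal p) haarAddCircle := fun b =>
    eLpNorm_congr_norm_ae (Filter.Eventually.of_forall fun t => by
      rw [norm_mul, fourier_apply, Circle.norm_coe, one_mul])
  rw [hlow, hfull]
  refine (eLpNorm_sub_le (by fun_prop) (by fun_prop) (by simpa using hp.le)).trans ?_
  rw [hnorm, hnorm, ENNReal.coe_add, ENNReal.coe_one, add_mul, one_mul]
  exact add_le_add le_rfl (hC a)

theorem IsSurfaceMeasure.isFiniteMeasure {m : ℕ} {σ : Measure (USphere m)}
    (hσ : IsSurfaceMeasure m σ) : IsFiniteMeasure σ :=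
  ⟨hσ.1 ▸ ENNReal.ofReal_lt_top⟩

theorem IsSurfaceMeasure.lintegral_smul {m : ℕ} {σ : Measure (USphere m)}
    (hσ : IsSurfaceMeasure m σ) {g : EuclideanSpace ℂ (Fin m) → ℝ≥0∞} (hg : Measurable g)
    {c : ℂ} (hc : ‖c‖ = 1) : ∫⁻ z : USphere m, g (c • (z : EuclideanSpace ℂ (Fin m))) ∂σ =
      ∫⁻ z : USphere m, g z ∂σ := by
  have hc0 : c ≠ 0 := by rintro rfl; simp at hc
  let U : EuclideanSpace ℂ (Fin m) ≃ₗᵢ[ℂ] EuclideanSpace ℂ (Fin m) :=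
    ⟨LinearEquiv.smulOfNeZero ℂ _ c hc0, fun z =>
      (norm_smul c z).trans (by rw [hc, one_mul])⟩
  have hU : Measurable (rotMap m U) :=
    ((U.continuous.comp continuous_subtype_val).subtype_mk _).measurable
  conv_rhs => rw [← hσ.2 U]
  exact (lintegral_map (hg.comp measurable_subtype_coe) hU).symm

theorem IsSurfaceMeasure.lintegral_eq_lintegral_lintegral {m : ℕ} {σ : Measure (USphere m)}
    (hσ : IsSurfaceMeasure m σ) {g : EuclideanSpace ℂ (Fin m) → ℝ≥0∞} (hg : Continuous g) :
    ∫⁻ z : USphere m, g z ∂σ = ∫⁻ z : USphere m, ∫⁻ t : AddCircle (2 * Real.pi),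
      g (fourier 1 t • (z : EuclideanSpace ℂ (Fin m))) ∂haarAddCircle ∂σ := by
  have := hσ.isFiniteMeasure
  rw [lintegral_lintegral_swap]
  · simp_rw [hσ.lintegral_smul hg.measurable
      (show ‖fourier 1 (_ : AddCircle (2 * Real.pi))‖ = 1 from Circle.norm_coe _)]
    simp
  · refine Measurable.aemeasurable (Continuous.measurable ?_)
    simp only [Function.uncurry_def]
    fun_prop

/-- Partial sums of expansions into homogeneous functions are uniformly bounded in `L^p` of the
sphere, by slicing with circles. -/
theorem exists_eLpNorm_sphere_partialSum_le {p : ℝ} (hp : 1 < p) :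
    ∃ C : ℝ≥0, ∀ {m : ℕ} {σ : Measure (USphere m)}, IsSurfaceMeasure m σ →
      ∀ F : ℕ → EuclideanSpace ℂ (Fin m) → ℂ, (∀ d, Continuous (F d)) →
      (∀ d (c : ℂ) z, F d (c • z) = c ^ d * F d z) → ∀ M N : ℕ,
      eLpNorm (fun z : USphere m => ∑ d ∈ Finset.range M, if d < N then F d z else 0)
          (ENNReal.ofReal p) σ ≤
        C * eLpNorm (fun z : USphere m => ∑ d ∈ Finset.range M, F d z) (ENNReal.ofReal p) σ := by
  obtain ⟨C, hC⟩ := exists_eLpNorm_partialSum_le hp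
  have hp0 : 0 < p := by linarith
  have hpE : ENNReal.ofReal p ≠ 0 := by simpa using hp0
  refine ⟨C, fun {m σ} hσ F hF hhom M N => ?_⟩
  have hLp : ∀ {α : Type} [MeasurableSpace α] (μ : Measure α) (f : α → ℂ),
      eLpNorm f (ENNReal.ofReal p) μ = (∫⁻ x, ‖f x‖ₑ ^ p ∂μ) ^ (1 / p) := fun μ f => by
    rw [eLpNorm_eq_lintegral_rpow_enorm_toReal hpE ENNReal.ofReal_ne_top,
      ENNReal.toReal_ofReal hp0.le]
  have hroot : ∀ A B : ℝ≥0∞, A ^ (1 / p) ≤ C * B ^ (1 / p) ↔ A ≤ (C : ℝ≥0∞) ^ p * B := fun A B => by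
    have h : (C : ℝ≥0∞) * B ^ (1 / p) = ((C : ℝ≥0∞) ^ p * B) ^ (1 / p) := by
      rw [ENNReal.mul_rpow_of_nonneg _ _ (by positivity), ← ENNReal.rpow_mul,
        mul_one_div_cancel hp0.ne', ENNReal.rpow_one]
    rw [h, ENNReal.rpow_le_rpow_iff (by positivity)]
  have hcont : ∀ s : Finset ℕ, Continuous fun z : EuclideanSpace ℂ (Fin m) =>
      ‖∑ d ∈ s, F d z‖ₑ ^ p := fun s => by fun_prop
  rw [hLp, hLp, hroot]
  simp only [← Finset.sum_filter]
  rw [hσ.lintegral_eq_lintegral_lintegral (hcont _), hσ.lintegral_eq_lintegral_lintegral (hcont _),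
    ← lintegral_const_mul' _ _ (by finiteness)]
  refine lintegral_mono fun z => ?_
  have h := hC (fun d => F d z) M N
  rw [hLp, hLp, hroot] at h
  simpa only [hhom, Finset.sum_filter] using h

end Riesz

theorem exists_nat_forall_eigenvalue_lt_iff {m : ℕ} (hm : 2 ≤ m) (R : ℝ) :
    ∃ N : ℕ, ∀ d : ℕ, ((d * (d + 2 * m - 2) : ℕ) : ℝ) < R ↔ d < N := by
  have hmono : Monotone fun d : ℕ => ((d * (d + 2 * m - 2) : ℕ) : ℝ) := fun a b hab => by
    dsimp only
    gcongr
  have hex : ∃ d : ℕ, R ≤ ((d * (d + 2 * m - 2) : ℕ) : ℝ) := by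
    obtain ⟨d, hd⟩ := exists_nat_ge R
    exact ⟨d, hd.trans (by exact_mod_cast Nat.le_mul_of_pos_right d (by omega))⟩
  classical
  refine ⟨Nat.find hex, fun d => ⟨fun h => ?_, fun h => not_le.mp (Nat.find_min hex h)⟩⟩
  by_contra! h2
  exact absurd ((Nat.find_spec hex).trans (hmono h2)) (not_le.mpr h)

/-- `T R` plays the role of `S^0_R(Δ_{S^{2m-1}}) = E_{Δ}([0,R))`, pinned down by
its action on spherical harmonics (eigenvalue `d(d+2m-2)`).  The conclusion is the uniform
`H^p → L^p` bound, stated on the dense subclass `A(∂B_m)` of `H^p`. -/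
theorem bochner_riesz_S0_Hp_bound (m : ℕ) (hm : 2 ≤ m) (p : ℝ≥0∞) (hp : 1 < p) (hp' : p ≠ ⊤)
    (σ : Measure (USphere m)) (hσ : IsSurfaceMeasure m σ)
    (T : ℝ → (Lp ℂ 2 σ →L[ℂ] Lp ℂ 2 σ))
    (hT : ∀ (R : ℝ) (d : ℕ) (F : EuclideanSpace ℂ (Fin m) → ℂ), IsSolidHarmonic m d F →
      ∀ g : Lp ℂ 2 σ, (∀ᵐ x ∂σ, g x = F ↑x) →
        T R g = if ((d * (d + 2 * m - 2) : ℕ) : ℝ) < R then g else 0) :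
    ∃ C : ℝ, ∀ R > (0 : ℝ), ∀ F : EuclideanSpace ℂ (Fin m) → ℂ, IsAnalyticBd m F →
      ∀ g : Lp ℂ 2 σ, (∀ᵐ x ∂σ, g x = F ↑x) →
        eLpNorm (⇑(T R g)) p σ ≤
          ENNReal.ofReal C * eLpNorm (fun x : USphere m => F ↑x) p σ := by
  have := hσ.isFiniteMeasure
  have h1p : Fact (1 ≤ p) := ⟨hp.le⟩
  have hpr : ENNReal.ofReal p.toReal = p := ENNReal.ofReal_toReal hp'
  obtain ⟨C, hC⟩ := exists_eLpNorm_sphere_partialSum_le (p := p.toReal)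
    (by rwa [← ENNReal.toReal_one, ENNReal.toReal_lt_toReal ENNReal.one_ne_top hp'])
  rw [hpr] at hC
  refine ⟨C, fun R _ F hF g hg => ?_⟩
  rw [ENNReal.ofReal_coe_nnreal]
  obtain ⟨N, hN⟩ := exists_nat_forall_eigenvalue_lt_iff hm R
  have hcont : ∀ d, Continuous (homogComp d F) := fun d =>
    (contDiff_homogComp d F 0).continuous
  let H : ℕ → C(USphere m, ℂ) := fun d =>
    ⟨fun z => homogComp d F z, (hcont d).comp continuous_subtype_val⟩
  let F₀ : C(USphere m, ℂ) := ⟨fun z => F z, hF.1.comp_continuous continuous_subtype_val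
    fun z => sphere_subset_closedBall z.2⟩
  have hgF : g = ContinuousMap.toLp 2 σ ℂ F₀ := by
    refine Lp.ext ?_
    filter_upwards [hg, ContinuousMap.coeFn_toLp (p := 2) σ (𝕜 := ℂ) F₀] with x h1 h2
    rw [h1, h2]
    rfl
  choose r M hrM using fun n : ℕ => hF.exists_partialSum_approx (Nat.one_div_pos_of_nat (n := n))
  let q : ℕ → C(USphere m, ℂ) := fun n => ∑ d ∈ Finset.range (M n), (r n : ℂ) ^ d • H d
  let s : ℕ → C(USphere m, ℂ) := fun n =>
    ∑ d ∈ Finset.range (M n), if d < N then (r n : ℂ) ^ d • H d else 0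
  have hqF : Filter.Tendsto q Filter.atTop (nhds F₀) := by
    rw [tendsto_iff_dist_tendsto_zero]
    refine squeeze_zero (fun _ => dist_nonneg) (fun n => ?_)
      (tendsto_one_div_add_atTop_nhds_zero_nat (𝕜 := ℝ))
    refine (ContinuousMap.dist_le (by positivity)).mpr fun z => ?_
    simpa [q, H, F₀, dist_eq_norm] using hrM n z
  have hTq : ∀ n, T R (ContinuousMap.toLp 2 σ ℂ (q n)) = ContinuousMap.toLp 2 σ ℂ (s n) := by
    intro n
    simp only [q, s, map_sum, map_smul]
    refine Finset.sum_congr rfl fun d _ => ?_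
    rw [hT R d _ (isSolidHarmonic_homogComp d F) _ (ContinuousMap.coeFn_toLp (p := 2) σ (H d))]
    simp only [hN]
    split_ifs <;> simp
  have hsq : ∀ n, eLpNorm (s n) p σ ≤ C * eLpNorm (q n) p σ := fun n => by
    have h := hC hσ (fun d z => (r n : ℂ) ^ d * homogComp d F z)
      (fun d => continuous_const.mul (hcont d))
      (fun d c z => by rw [homogComp_smul]; ring) (M n) N
    convert h using 2
    · ext z
      simp only [s, ContinuousMap.sum_apply]
      refine Finset.sum_congr rfl fun d _ => ?_
      split_ifs <;> simp [H]
    · congr 1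
      ext z
      simp [q, H]
  have hlimq : Filter.Tendsto (fun n => (C : ℝ≥0∞) * eLpNorm (q n) p σ) Filter.atTop
      (nhds (C * eLpNorm F₀ p σ)) := by
    have h : ∀ f : C(USphere m, ℂ), eLpNorm f p σ = ‖ContinuousMap.toLp p σ ℂ f‖ₑ := fun f => by
      rw [Lp.enorm_def]
      exact eLpNorm_congr_ae (ContinuousMap.coeFn_toLp σ f).symm
    simp only [h]
    refine ENNReal.Tendsto.const_mul ?_ (Or.inr ENNReal.coe_ne_top)
    exact ((ContinuousMap.toLp p σ ℂ).continuous.enorm.tendsto F₀).comp hqF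
  have hlims : Filter.Tendsto (fun n => ContinuousMap.toLp 2 σ ℂ (s n)) Filter.atTop
      (nhds (T R g)) := by
    simp only [← hTq, hgF]
    exact (((T R).continuous.comp (ContinuousMap.toLp 2 σ ℂ).continuous).tendsto F₀).comp hqF
  obtain ⟨k, hk, hae⟩ := (tendstoInMeasure_of_tendsto_Lp hlims).exists_seq_tendsto_ae
  calc eLpNorm (⇑(T R g)) p σ
      ≤ Filter.atTop.liminf fun n => eLpNorm (ContinuousMap.toLp 2 σ ℂ (s (k n))) p σ :=
        Lp.eLpNorm_lim_le_liminf_eLpNorm (fun n => Lp.aestronglyMeasurable _) _ hae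
    _ ≤ Filter.atTop.liminf fun n => (C : ℝ≥0∞) * eLpNorm (q (k n)) p σ := by
        refine Filter.liminf_le_liminf (Filter.Eventually.of_forall fun n => ?_)
        rw [eLpNorm_congr_ae (ContinuousMap.coeFn_toLp (p := 2) σ (𝕜 := ℂ) (s (k n)))]
        exact hsq (k n)
    _ = _ := (hlimq.comp hk.tendsto_atTop).liminf_eq
end
end

section
/- Let 0 < ω ≤ π/2 and let b be holomorphic and bounded on the sector Σ_ω = {z ∈ C : |arg z| ≤ ω}. Then for every s > 0 there is a constant C_s independent of b and ω such that sup_{t>0} ‖η · δ_t b‖_{H_s} ≤ (C_s / ω^s) ‖b‖_{L^∞(Σ_ω)}, where δ_t b(λ) = b(tλ), H_s is the Sobolev space of order s, and η ∈ C_c^∞(R_+) is a fixed function, not identically zero. -/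
/-!
STATEMENT 6: Let 0 < ω ≤ π/2 and let b be holomorphic and bounded on the sector
Σ_ω = {z ∈ ℂ : |arg z| ≤ ω}.  Then for every s > 0 there is a constant C_s, independent of
b and ω, such that sup_{t>0} ‖η · δ_t b‖_{H_s} ≤ (C_s/ω^s) ‖b‖_{L^∞(Σ_ω)}, where
δ_t b(λ) = b(tλ), H_s is the Sobolev space of order s, and η ∈ C_c^∞(ℝ_+) is a fixed
function, not identically zero.

Formalization notes: the Sobolev norm is `‖g‖_{H_s} = (∫ (1+ξ²)^s |ĝ(ξ)|² dξ)^{1/2}`,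
expressed in `ℝ≥0∞` via the Fourier transform; `Σ_ω` excludes the origin (as usual for
sectors in holomorphic functional calculus).
-/

open MeasureTheory Complex
open scoped ENNReal NNReal

noncomputable section

/-- The closed sector `Σ_ω = {z ≠ 0 : |arg z| ≤ ω}`. -/
def Sector (ω : ℝ) : Set ℂ := {z : ℂ | z ≠ 0 ∧ |Complex.arg z| ≤ ω}

/-- One-dimensional Fourier transform. -/
def F1 (g : ℝ → ℂ) (ξ : ℝ) : ℂ :=
  ∫ x : ℝ, Complex.exp (-2 * Real.pi * Complex.I * ((x * ξ : ℝ) : ℂ)) * g x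

/-- The Sobolev `H_s` norm, `‖g‖_{H_s} = (∫ (1+ξ²)^s |ĝ(ξ)|² dξ)^{1/2}`, valued in `ℝ≥0∞`. -/
def sobolevNorm (s : ℝ) (g : ℝ → ℂ) : ℝ≥0∞ :=
  (∫⁻ ξ : ℝ, ENNReal.ofReal ((1 + ξ ^ 2) ^ s) * (‖F1 g ξ‖₊ : ℝ≥0∞) ^ 2) ^ ((1 : ℝ) / 2)

/-- The open disc of radius `x * sin ω` around `x > 0` is tangent to the boundary of the sector. -/
lemma ball_subset_sector {ω x : ℝ} (hω : 0 < ω) (hω' : ω ≤ Real.pi / 2) (hx : 0 < x) :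
    Metric.ball (x : ℂ) (x * Real.sin ω) ⊆ Sector ω := by
  intro z hz
  rw [mem_ball_iff_norm] at hz
  have hsin : 0 < Real.sin ω := Real.sin_pos_of_pos_of_lt_pi hω (by linarith [Real.pi_pos])
  have hz2 : (z.re - x) ^ 2 + z.im ^ 2 < (x * Real.sin ω) ^ 2 := by
    have h1 : ‖z - x‖ ^ 2 < (x * Real.sin ω) ^ 2 := pow_lt_pow_left₀ hz (norm_nonneg _) two_ne_zero
    rw [Complex.sq_norm, Complex.normSq_apply] at h1
    simp only [sub_re, ofReal_re, sub_im, ofReal_im, sub_zero] at h1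
    nlinarith
  have hsc := Real.sin_sq_add_cos_sq ω
  have hz0 : z ≠ 0 := by
    rintro rfl
    simp only [zero_re, zero_im] at hz2
    nlinarith [sq_nonneg (x * Real.cos ω)]
  refine ⟨hz0, ?_⟩
  by_contra! hlt
  have hcos : Real.cos |z.arg| < Real.cos ω :=
    Real.cos_lt_cos_of_nonneg_of_le_pi hω.le (Complex.abs_arg_le_pi z) hlt
  rw [Real.cos_abs] at hcos
  have hre : z.re = ‖z‖ * Real.cos z.arg := (Complex.norm_mul_cos_arg z).symm
  have hnz : 0 < ‖z‖ := norm_pos_iff.mpr hz0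
  have hre' : z.re < ‖z‖ * Real.cos ω := by rw [hre]; gcongr
  have hn : ‖z‖ ^ 2 = z.re ^ 2 + z.im ^ 2 := by
    rw [Complex.sq_norm, Complex.normSq_apply]; ring
  have h2 := mul_lt_mul_of_pos_left hre' hx
  have h3 : (x * Real.sin ω) ^ 2 = x ^ 2 - x ^ 2 * Real.cos ω ^ 2 := by
    linear_combination x ^ 2 * hsc
  nlinarith [sq_nonneg (‖z‖ - x * Real.cos ω)]

lemma closedBall_subset_sector {ω a x : ℝ} (hω : 0 < ω) (hω' : ω ≤ Real.pi / 2) (ha : 0 < a)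
    (hx : a ≤ x) : Metric.closedBall (x : ℂ) (a * ω / 4) ⊆ Sector ω := by
  refine (Metric.closedBall_subset_ball ?_).trans (ball_subset_sector hω hω' (ha.trans_le hx))
  have h1 := Real.mul_le_sin hω.le hω'
  have h2 : (1 : ℝ) / 2 ≤ 2 / Real.pi := by
    rw [div_le_div_iff₀ two_pos Real.pi_pos]; linarith [Real.pi_le_four]
  have h3 : ω / 2 ≤ Real.sin ω := by nlinarith
  have h4 : a * (ω / 2) ≤ x * Real.sin ω := by gcongr; linarith
  nlinarith [mul_pos ha hω]

lemma smul_mem_sector {ω t : ℝ} (ht : 0 < t) {z : ℂ} (hz : z ∈ Sector ω) :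
    (t : ℂ) * z ∈ Sector ω :=
  ⟨mul_ne_zero (by exact_mod_cast ht.ne') hz.1, by
    rw [Complex.arg_real_mul z ht]; exact hz.2⟩

lemma analyticAt_of_differentiableOn_sector {ω x : ℝ} (hω : 0 < ω) (hω' : ω ≤ Real.pi / 2)
    (hx : 0 < x) {B : ℂ → ℂ} (hB : DifferentiableOn ℂ B (Sector ω)) : AnalyticAt ℂ B x :=
  (hB.mono (ball_subset_sector hω hω' hx)).analyticAt (Metric.ball_mem_nhds _
    (mul_pos hx (Real.sin_pos_of_pos_of_lt_pi hω (by linarith [Real.pi_pos]))))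

lemma iteratedDeriv_comp_ofReal {B : ℂ → ℂ} {s : Set ℝ} (hs : IsOpen s)
    (hB : ∀ x ∈ s, AnalyticAt ℂ B x) (n : ℕ) :
    ∀ x ∈ s, iteratedDeriv n (fun y : ℝ => B y) x = iteratedDeriv n B x := by
  induction n with
  | zero => simp
  | succ n ih =>
    intro x hx
    rw [iteratedDeriv_succ, iteratedDeriv_succ]
    have h : iteratedDeriv n (fun y : ℝ => B y) =ᶠ[nhds x] fun y : ℝ => iteratedDeriv n B y :=
      Filter.mem_of_superset (hs.mem_nhds hx) ih
    rw [h.deriv_eq]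
    rw [iteratedDeriv_eq_iterate]
    exact ((hB x hx).iterated_deriv n).differentiableAt.hasDerivAt.comp_ofReal.deriv

lemma contDiff_mul_of_tsupport_subset {f η : ℝ → ℂ} {s : Set ℝ} {n : ℕ∞}
    (hη : ContDiff ℝ n η) (hsupp : tsupport η ⊆ s) (hf : ∀ x ∈ s, ContDiffAt ℝ n f x) :
    ContDiff ℝ n (fun x => η x * f x) := by
  rw [contDiff_iff_contDiffAt]
  intro x
  by_cases hx : x ∈ tsupport η
  · exact hη.contDiffAt.mul (hf x (hsupp hx))
  · refine (contDiffAt_const (c := (0 : ℂ))).congr_of_eventuallyEq ?_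
    filter_upwards [(isClosed_tsupport η).isOpen_compl.mem_nhds hx] with y hy
    rw [image_eq_zero_of_notMem_tsupport hy, zero_mul]

lemma F1_eq_fourier (g : ℝ → ℂ) : F1 g = FourierTransform.fourier g := by
  ext ξ
  rw [Real.fourier_real_eq_integral_exp_smul]
  refine integral_congr_ae (Filter.Eventually.of_forall fun x => ?_)
  simp only [smul_eq_mul]
  congr 2
  push_cast
  ring

lemma lintegral_F1_sq_le {h : ℝ → ℂ} {a A B : ℝ} (haA : a ≤ A) (hh : ContDiff ℝ (⊤ : ℕ∞) h)
    (hc : HasCompactSupport h) (hsupp : ∀ x ∉ Set.Icc a A, h x = 0) (hB : ∀ x, ‖h x‖ ≤ B) :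
    ∫⁻ ξ : ℝ, (‖F1 h ξ‖₊ : ℝ≥0∞) ^ 2 ≤ ENNReal.ofReal (B ^ 2 * (A - a)) := by
  have hB0 : 0 ≤ B := (norm_nonneg _).trans (hB 0)
  let H := hc.toSchwartzMap hh
  have hpl := SchwartzMap.integral_norm_sq_fourier H
  have e : ∀ ξ, F1 h ξ = (FourierTransform.fourier H) ξ := fun ξ => by
    rw [F1_eq_fourier, SchwartzMap.fourier_coe]; rfl
  have hint : Integrable (fun ξ => ‖(FourierTransform.fourier H) ξ‖ ^ 2) :=
    ((FourierTransform.fourier H).memLp 2).integrable_norm_pow (by norm_num)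
  have e2 : ∀ ξ, (‖F1 h ξ‖₊ : ℝ≥0∞) ^ 2 =
      ENNReal.ofReal (‖(FourierTransform.fourier H) ξ‖ ^ 2) := fun ξ => by
    rw [e, ENNReal.ofReal_pow (norm_nonneg _), ofReal_norm]; rfl
  simp_rw [e2]
  rw [← ofReal_integral_eq_lintegral_ofReal hint (Filter.Eventually.of_forall fun _ => by positivity),
    hpl]
  refine ENNReal.ofReal_le_ofReal ?_
  change ∫ x, ‖h x‖ ^ 2 ≤ _
  rw [← setIntegral_eq_integral_of_forall_compl_eq_zero (s := Set.Icc a A)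
    (fun x hx => by rw [hsupp x hx]; simp)]
  have := norm_setIntegral_le_of_norm_le_const (μ := volume) (s := Set.Icc a A)
    (f := fun x => ‖h x‖ ^ 2) (C := B ^ 2) (by simp) (fun x _ => by
      rw [Real.norm_of_nonneg (by positivity)]; gcongr; exact hB x)
  rw [Real.volume_real_Icc_of_le haA] at this
  exact (le_abs_self _).trans this

lemma rpow_one_add_sq_le {s ω : ℝ} (hs : 0 < s) (hω : 0 < ω) (hω2 : ω ≤ 2) {k : ℕ} (hk : s ≤ k)
    (ξ : ℝ) :
    (1 + ξ ^ 2) ^ s ≤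
      (ω ^ s)⁻¹ ^ 2 * ((1 + 8 ^ k) + 2 ^ k * ω ^ (2 * k) * |2 * Real.pi * ξ| ^ (2 * k)) := by
  have hy : 0 < 1 + ξ ^ 2 := by positivity
  have h1 : (ω ^ 2 * (1 + ξ ^ 2)) ^ s ≤ 1 + (ω ^ 2 * (1 + ξ ^ 2)) ^ k := by
    rcases le_total (ω ^ 2 * (1 + ξ ^ 2)) 1 with h | h
    · have := Real.rpow_le_one (by positivity) h hs.le
      have : 0 ≤ (ω ^ 2 * (1 + ξ ^ 2)) ^ k := by positivity
      linarith
    · have := Real.rpow_le_rpow_of_exponent_le h hk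
      rw [Real.rpow_natCast] at this
      linarith
  have h2 : (ω ^ 2 * (1 + ξ ^ 2)) ^ s = (ω ^ s) ^ 2 * (1 + ξ ^ 2) ^ s := by
    rw [Real.mul_rpow (by positivity) hy.le, ← Real.rpow_natCast_mul hω.le,
      ← Real.rpow_mul_natCast hω.le, mul_comm s]
  have h3 : (1 + ξ ^ 2) ^ k ≤ 2 ^ k * (1 + ξ ^ (2 * k)) := by
    have := add_pow_le zero_le_one (sq_nonneg ξ) k
    rw [one_pow, ← pow_mul] at this
    refine this.trans ?_
    gcongr
    · rw [pow_mul]; positivity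
    · norm_num
    · omega
  have h4 : ξ ^ (2 * k) ≤ |2 * Real.pi * ξ| ^ (2 * k) := by
    rw [pow_mul, pow_mul, sq_abs]
    refine pow_le_pow_left₀ (sq_nonneg ξ) ?_ k
    rw [mul_pow]
    nlinarith [sq_nonneg ξ, Real.pi_gt_three, sq_nonneg (2 * Real.pi), mul_nonneg (sq_nonneg ξ)
      (show 0 ≤ (2 * Real.pi) ^ 2 - 1 by nlinarith [Real.pi_gt_three])]
  have h5 : ω ^ (2 * k) ≤ 4 ^ k := by
    rw [pow_mul]; gcongr; nlinarith
  have hωs : 0 < (ω ^ s) ^ 2 := by positivity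
  rw [inv_pow, ← div_eq_inv_mul, le_div_iff₀ hωs, mul_comm, ← h2]
  refine h1.trans ?_
  rw [mul_pow, ← pow_mul]
  have h8 : (8 : ℝ) ^ k = 2 ^ k * 4 ^ k := by rw [← mul_pow]; norm_num
  have h6 : ω ^ (2 * k) * (1 + ξ ^ 2) ^ k ≤
      ω ^ (2 * k) * (2 ^ k * (1 + |2 * Real.pi * ξ| ^ (2 * k))) := by
    gcongr
    exact h3.trans (by gcongr)
  have h7 : (2 : ℝ) ^ k * ω ^ (2 * k) ≤ 2 ^ k * 4 ^ k := by gcongr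
  rw [h8]
  linarith

lemma support_iteratedDeriv_subset (n : ℕ) (g : ℝ → ℂ) :
    Function.support (iteratedDeriv n g) ⊆ tsupport g := by
  intro x hx
  refine support_iteratedFDeriv_subset (𝕜 := ℝ) n ?_
  rwa [Function.mem_support, ← norm_ne_zero_iff, norm_iteratedFDeriv_eq_norm_iteratedDeriv,
    norm_ne_zero_iff]

lemma F1_iteratedDeriv {g : ℝ → ℂ} (hg : ContDiff ℝ (⊤ : ℕ∞) g) (hc : HasCompactSupport g) (k : ℕ)
    (ξ : ℝ) : ‖F1 (iteratedDeriv k g) ξ‖ = |2 * Real.pi * ξ| ^ k * ‖F1 g ξ‖ := by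
  have hint : ∀ n : ℕ, (n : ℕ∞) ≤ ⊤ → Integrable (iteratedDeriv n g) := fun n _ =>
    (hg.continuous_iteratedDeriv n (by exact_mod_cast le_top)).integrable_of_hasCompactSupport
      (hc.mono' (support_iteratedDeriv_subset n g))
  rw [F1_eq_fourier, F1_eq_fourier, Real.fourier_iteratedDeriv hg hint le_top, norm_smul, norm_pow]
  congr 2
  simp [abs_mul]

lemma exists_iteratedDeriv_mul_le {η : ℝ → ℂ} {a : ℝ} (ha : 0 < a)
    (hη : ContDiff ℝ (⊤ : ℕ∞) η) (hc : HasCompactSupport η) (hsupp : tsupport η ⊆ Set.Ici a)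
    (k : ℕ) :
    ∃ K : ℝ, ∀ ω : ℝ, 0 < ω → ω ≤ Real.pi / 2 →
      ∀ B : ℂ → ℂ, DifferentiableOn ℂ B (Sector ω) →
      ∀ M : ℝ, (∀ z ∈ Sector ω, ‖B z‖ ≤ M) →
      ∀ x : ℝ, ‖iteratedDeriv k (fun y : ℝ => η y * B y) x‖ ≤ K * M / ω ^ k := by
  have hE : ∀ i : ℕ, ∃ E, ∀ x, ‖iteratedDeriv i η x‖ ≤ E := fun i =>
    (hc.mono' (support_iteratedDeriv_subset i η)).exists_bound_of_continuous
      (hη.continuous_iteratedDeriv i (by exact_mod_cast le_top))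
  choose E hE using hE
  have hE0 : ∀ i, 0 ≤ E i := fun i => (norm_nonneg _).trans (hE i 0)
  refine ⟨∑ i ∈ Finset.range (k + 1),
    k.choose i * (E i * 2 ^ i) * ((k - i).factorial * (4 / a) ^ (k - i)), ?_⟩
  intro ω hω hω' B hB M hM x
  have hM0 : 0 ≤ M := by
    refine (norm_nonneg _).trans (hM 1 ⟨one_ne_zero, ?_⟩)
    simpa using hω.le
  have hω2 : ω ≤ 2 := by linarith [Real.pi_le_four]
  have hana : ∀ y ∈ Set.Ioi (0 : ℝ), AnalyticAt ℂ B y := fun y hy =>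
    analyticAt_of_differentiableOn_sector hω hω' hy hB
  by_cases hx : x ∈ tsupport η
  · have hax : a ≤ x := hsupp hx
    have hx0 : 0 < x := ha.trans_le hax
    have hr : 0 < a * ω / 4 := by positivity
    have hball := closedBall_subset_sector hω hω' ha hax
    have hfd : ContDiffAt ℝ k (fun y : ℝ => B y) x :=
      ((hana x hx0).contDiffAt.restrict_scalars ℝ).comp x Complex.ofRealCLM.contDiff.contDiffAt
    rw [iteratedDeriv_fun_mul (hη.contDiffAt.of_le (by exact_mod_cast le_top)) hfd, Finset.sum_mul,
      Finset.sum_div]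
    refine (norm_sum_le _ _).trans (Finset.sum_le_sum fun i hi => ?_)
    have hik : i ≤ k := Nat.lt_succ_iff.mp (Finset.mem_range.mp hi)
    have hcauchy := Complex.norm_iteratedDeriv_le_of_forall_mem_sphere_norm_le (k - i) hr
      ((hB.mono hball).diffContOnCl_ball subset_rfl)
      (fun z hz => hM z (hball (Metric.sphere_subset_closedBall hz)))
    rw [iteratedDeriv_comp_ofReal isOpen_Ioi hana _ x hx0, norm_mul, norm_mul, Complex.norm_natCast]
    calc _ ≤ (k.choose i : ℝ) * E i * ((k - i).factorial * M / (a * ω / 4) ^ (k - i)) := by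
          gcongr
          · exact mul_nonneg (Nat.cast_nonneg _) (hE0 i)
          · exact hE i x
      _ = (k.choose i : ℝ) * (E i * ω ^ i) * ((k - i).factorial * (4 / a) ^ (k - i)) * M
            / ω ^ k := by
          obtain ⟨j, rfl⟩ := Nat.exists_eq_add_of_le hik
          have hj : (4 / a) ^ j * (a * ω / 4) ^ j = ω ^ j := by
            rw [← mul_pow]; congr 1; field_simp
          rw [Nat.add_sub_cancel_left, pow_add, ← hj]
          field_simp
      _ ≤ _ := by
          have := hE0 i
          gcongr
  · have h0 : iteratedDeriv k (fun y : ℝ => η y * B y) x = 0 := by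
      by_contra h
      exact hx (closure_mono (Function.support_mul_subset_left _ _)
        (support_iteratedDeriv_subset k _ h))
    rw [h0, norm_zero]
    have : 0 ≤ ∑ i ∈ Finset.range (k + 1),
        k.choose i * (E i * 2 ^ i) * ((k - i).factorial * (4 / a) ^ (k - i)) :=
      Finset.sum_nonneg fun i _ => by have := hE0 i; positivity
    positivity

theorem sector_holomorphic_sobolev_bound (s : ℝ) (hs : 0 < s)
    (η : ℝ → ℂ) (hη₁ : ContDiff ℝ (⊤ : ℕ∞) η) (hη₂ : HasCompactSupport η)
    (hη₃ : tsupport η ⊆ Set.Ioi (0 : ℝ)) (hη₄ : η ≠ 0) :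
    ∃ C : ℝ, ∀ ω : ℝ, 0 < ω → ω ≤ Real.pi / 2 →
      ∀ b : ℂ → ℂ, DifferentiableOn ℂ b (Sector ω) →
      ∀ M : ℝ, (∀ z ∈ Sector ω, ‖b z‖ ≤ M) →
      ∀ t > (0 : ℝ),
        sobolevNorm s (fun lam : ℝ => η lam * b ((t * lam : ℝ) : ℂ)) ≤
          ENNReal.ofReal (C / ω ^ s * M) := by
  obtain ⟨a, A, ha, haA, hsupp⟩ : ∃ a A : ℝ, 0 < a ∧ a ≤ A ∧ tsupport η ⊆ Set.Icc a A := by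
    have hne : (tsupport η).Nonempty := by
      rwa [Set.nonempty_iff_ne_empty, Ne, tsupport_eq_empty_iff]
    obtain ⟨a, haη, ha⟩ := IsCompact.exists_isLeast hη₂ hne
    obtain ⟨A, -, hA⟩ := IsCompact.exists_isGreatest hη₂ hne
    exact ⟨a, A, hη₃ haη, hA haη, fun x hx => ⟨ha hx, hA hx⟩⟩
  obtain ⟨k, hk⟩ := exists_nat_ge s
  have hsuppa : tsupport η ⊆ Set.Ici a := hsupp.trans Set.Icc_subset_Ici_self
  obtain ⟨K₀, hK₀⟩ := exists_iteratedDeriv_mul_le ha hη₁ hη₂ hsuppa 0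
  obtain ⟨K, hK⟩ := exists_iteratedDeriv_mul_le ha hη₁ hη₂ hsuppa k
  set D : ℝ := (A - a) * ((1 + 8 ^ k) * K₀ ^ 2 + 2 ^ k * K ^ 2) with hD
  have hAa : 0 ≤ A - a := sub_nonneg.mpr haA
  have hD0 : 0 ≤ D := by positivity
  refine ⟨√D, fun ω hω hω' b hb M hM t ht => ?_⟩
  have hω2 : ω ≤ 2 := by linarith [Real.pi_le_four]
  have hM0 : 0 ≤ M := by
    refine (norm_nonneg _).trans (hM 1 ⟨one_ne_zero, ?_⟩)
    simpa using hω.le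
  set B : ℂ → ℂ := fun z => b (t * z) with hBdef
  have hB : DifferentiableOn ℂ B (Sector ω) :=
    hb.comp (by fun_prop) fun z hz => smul_mem_sector ht hz
  have hBM : ∀ z ∈ Sector ω, ‖B z‖ ≤ M := fun z hz => hM _ (smul_mem_sector ht hz)
  have hg : (fun lam : ℝ => η lam * b ((t * lam : ℝ) : ℂ)) = fun lam : ℝ => η lam * B lam := by
    ext; simp [hBdef]
  rw [hg]
  set g : ℝ → ℂ := fun lam => η lam * B lam with hgdef
  have hgs : ContDiff ℝ (⊤ : ℕ∞) g := contDiff_mul_of_tsupport_subset hη₁ hη₃ fun x hx =>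
    ((analyticAt_of_differentiableOn_sector hω hω' hx hB).contDiffAt.restrict_scalars ℝ).comp x
      Complex.ofRealCLM.contDiff.contDiffAt
  have hgc : HasCompactSupport g := hη₂.mul_right
  have hgsupp : tsupport g ⊆ Set.Icc a A :=
    (closure_mono (Function.support_mul_subset_left _ _)).trans hsupp
  have hL : ∀ (n : ℕ) (L : ℝ), (∀ x, ‖iteratedDeriv n g x‖ ≤ L) →
      ∫⁻ ξ : ℝ, (‖F1 (iteratedDeriv n g) ξ‖₊ : ℝ≥0∞) ^ 2 ≤ ENNReal.ofReal (L ^ 2 * (A - a)) := by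
    intro n L hL
    refine lintegral_F1_sq_le haA ?_ (hgc.mono' (support_iteratedDeriv_subset n g))
      (fun x hx => ?_) hL
    · rw [iteratedDeriv_eq_iterate]
      exact hgs.iterate_deriv n
    · by_contra h
      exact hx (hgsupp (support_iteratedDeriv_subset n g h))
  have h0 := hL 0 _ (hK₀ ω hω hω' B hB M hBM)
  have h1 := hL k _ (hK ω hω hω' B hB M hBM)
  rw [iteratedDeriv_zero] at h0
  have hωs : 0 < ω ^ s := Real.rpow_pos_of_pos hω s
  have hpt : ∀ ξ : ℝ, ENNReal.ofReal ((1 + ξ ^ 2) ^ s) * (‖F1 g ξ‖₊ : ℝ≥0∞) ^ 2 ≤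
      ENNReal.ofReal ((ω ^ s)⁻¹ ^ 2 * (1 + 8 ^ k)) * (‖F1 g ξ‖₊ : ℝ≥0∞) ^ 2 +
      ENNReal.ofReal ((ω ^ s)⁻¹ ^ 2 * (2 ^ k * ω ^ (2 * k))) *
        (‖F1 (iteratedDeriv k g) ξ‖₊ : ℝ≥0∞) ^ 2 := by
    intro ξ
    have hn : ∀ z : ℂ, (‖z‖₊ : ℝ≥0∞) ^ 2 = ENNReal.ofReal (‖z‖ ^ 2) := fun z => by
      rw [ENNReal.ofReal_pow (norm_nonneg _), ofReal_norm]; rfl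
    rw [hn, hn, ← ENNReal.ofReal_mul (by positivity), ← ENNReal.ofReal_mul (by positivity),
      ← ENNReal.ofReal_mul (by positivity), ← ENNReal.ofReal_add (by positivity) (by positivity),
      F1_iteratedDeriv hgs hgc]
    refine ENNReal.ofReal_le_ofReal ?_
    refine (mul_le_mul_of_nonneg_right (rpow_one_add_sq_le hs hω hω2 hk ξ)
      (sq_nonneg _)).trans_eq ?_
    ring
  have hmeas : Measurable fun ξ => (‖F1 g ξ‖₊ : ℝ≥0∞) ^ 2 := by
    have : Continuous (F1 g) := by
      rw [F1_eq_fourier]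
      exact (FourierTransform.fourier (hgc.toSchwartzMap hgs)).continuous
    exact (this.measurable.nnnorm.coe_nnreal_ennreal).pow_const 2
  have hint : ∫⁻ ξ : ℝ, ENNReal.ofReal ((1 + ξ ^ 2) ^ s) * (‖F1 g ξ‖₊ : ℝ≥0∞) ^ 2 ≤
      ENNReal.ofReal ((√D / ω ^ s * M) ^ 2) := by
    refine (lintegral_mono hpt).trans ?_
    rw [lintegral_add_left (hmeas.const_mul _), lintegral_const_mul' _ _ ENNReal.ofReal_ne_top,
      lintegral_const_mul' _ _ ENNReal.ofReal_ne_top]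
    refine (add_le_add (mul_le_mul_right h0 _) (mul_le_mul_right h1 _)).trans_eq ?_
    rw [← ENNReal.ofReal_mul (by positivity), ← ENNReal.ofReal_mul (by positivity),
      ← ENNReal.ofReal_add (by positivity) (by positivity)]
    congr 1
    rw [mul_pow (√D / ω ^ s), div_pow √D, Real.sq_sqrt hD0, hD, pow_zero, div_one, pow_mul']
    field_simp
  rw [sobolevNorm]
  refine (ENNReal.rpow_le_rpow hint (by norm_num)).trans_eq ?_
  have hnn : 0 ≤ √D / ω ^ s * M := by positivity
  rw [ENNReal.ofReal_rpow_of_nonneg (by positivity) (by norm_num), ← Real.sqrt_eq_rpow,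
    Real.sqrt_sq hnn]
end
end
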